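/- arXiv:2003.08247 — 4 statements merged into one kernel-verified Lean document; each statement's English description precedes it below -/
import Mathlib

section
/- Let 1 < k ≤ n. If F_1, ..., F_{2n+k-3} are nonempty sets of edges in a bipartite graph such that the union of every k of them contains a matching of size n, then there exists a rainbow matching of size n. -/
/-- A set of edges of a bipartite graph (edges given as pairs) is a matching
if distinct edges share no endpoint. -/
def IsMatching {α β : Type*} (M : Set (α × β)) : Prop :=
  ∀ e ∈ M, ∀ f ∈ M, e ≠ f → e.1 ≠ f.1 ∧ e.2 ≠ f.2

/-- `F` contains a matching of size `n`. -/
def HasMatchingOfSize {α β : Type*} (n : ℕ) (F : Set (α × β)) : Prop :=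
  ∃ e : Fin n → α × β, Function.Injective e ∧ (∀ j, e j ∈ F) ∧
    IsMatching (Set.range e)

/-- The family `F` has a rainbow matching of size `n`: `n` pairwise disjoint
edges chosen from `n` distinct members of the family. -/
def HasRainbowMatchingOfSize {α β ι : Type*} (n : ℕ) (F : ι → Set (α × β)) : Prop :=
  ∃ (g : Fin n ↪ ι) (e : Fin n → α × β), Function.Injective e ∧
    (∀ j, e j ∈ F (g j)) ∧ IsMatching (Set.range e)

/-- The edges `(a j, b j)`, coloured by `g j`, form a rainbow matching for the family `F`. -/
structure IsRainbow {α β ι : Type*} (F : ι → Set (α × β)) {m : ℕ}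
    (a : Fin m → α) (b : Fin m → β) (g : Fin m → ι) : Prop where
  inj_left : Function.Injective a
  inj_right : Function.Injective b
  inj_colour : Function.Injective g
  mem : ∀ j, (a j, b j) ∈ F (g j)

theorem injective_update {γ δ : Type*} [DecidableEq γ] {f : γ → δ}
    (hf : Function.Injective f) (i : γ) {y : δ} (hy : ∀ j, f j ≠ y) :
    Function.Injective (Function.update f i y) := by
  intro p q hpq
  by_cases hp : p = i <;> by_cases hq : q = i
  · rw [hp, hq]
  · subst hp
    simp only [Function.update_self, Function.update_of_ne hq] at hpq
    exact absurd hpq.symm (hy q)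
  · subst hq
    simp only [Function.update_self, Function.update_of_ne hp] at hpq
    exact absurd hpq (hy p)
  · simp only [Function.update_of_ne hq, Function.update_of_ne hp] at hpq
    exact hf hpq

namespace IsRainbow

variable {α β ι : Type*} {F : ι → Set (α × β)} {m : ℕ}
  {a : Fin m → α} {b : Fin m → β} {g : Fin m → ι}

theorem update (h : IsRainbow F a b g) (i : Fin m) {y : β} {c : ι}
    (hy : ∀ j, b j ≠ y) (hc : ∀ j, g j ≠ c) (hF : (a i, y) ∈ F c) :
    IsRainbow F a (Function.update b i y) (Function.update g i c) where
  inj_left := h.inj_left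
  inj_right := injective_update h.inj_right i hy
  inj_colour := injective_update h.inj_colour i hc
  mem j := by
    by_cases hj : j = i
    · subst hj
      simpa using hF
    · simpa [Function.update_of_ne hj] using h.mem j

theorem cons (h : IsRainbow F a b g) {x : α} {y : β} {c : ι}
    (hx : ∀ j, a j ≠ x) (hy : ∀ j, b j ≠ y) (hc : ∀ j, g j ≠ c) (hF : (x, y) ∈ F c) :
    IsRainbow F (Fin.cons x a : Fin (m + 1) → α) (Fin.cons y b : Fin (m + 1) → β)
      (Fin.cons c g : Fin (m + 1) → ι) where
  inj_left := Fin.cons_injective_iff.2 ⟨fun ⟨j, hj⟩ => hx j hj, h.inj_left⟩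
  inj_right := Fin.cons_injective_iff.2 ⟨fun ⟨j, hj⟩ => hy j hj, h.inj_right⟩
  inj_colour := Fin.cons_injective_iff.2 ⟨fun ⟨j, hj⟩ => hc j hj, h.inj_colour⟩
  mem j := by
    refine Fin.cases ?_ (fun i => ?_) j
    · simpa using hF
    · simpa using h.mem i

theorem hasRainbowMatchingOfSize (h : IsRainbow F a b g) : HasRainbowMatchingOfSize m F := by
  refine ⟨⟨g, h.inj_colour⟩, fun j => (a j, b j), ?_, h.mem, ?_⟩
  · intro p q hpq
    exact h.inj_left (congrArg Prod.fst hpq)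
  · rintro _ ⟨p, rfl⟩ _ ⟨q, rfl⟩ hpq
    have hne : p ≠ q := fun hh => hpq (by rw [hh])
    exact ⟨h.inj_left.ne hne, h.inj_right.ne hne⟩

end IsRainbow

/-- Every right vertex other than the `b j` with `j ∉ R` can be avoided by a rainbow matching
with the same left vertices, which uses only the colours of `g` and those in `U`, and agrees with
`b` outside `R`. -/
def Releasable {α β ι : Type*} (F : ι → Set (α × β)) {m : ℕ} (a : Fin m → α) (b : Fin m → β)
    (g : Fin m → ι) (R : Finset (Fin m)) (U : Finset ι) : Prop :=
  ∀ y, (∀ j ∉ R, b j ≠ y) → ∃ b' g', IsRainbow F a b' g' ∧ (∀ j, b' j ≠ y) ∧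
    (∀ j ∉ R, b' j = b j) ∧ ∀ j, g' j ∈ Set.range g ∨ g' j ∈ U

theorem Releasable.insert {α β ι : Type*} [DecidableEq ι] {F : ι → Set (α × β)} {m : ℕ}
    {a : Fin m → α} {b : Fin m → β} {g : Fin m → ι} {R : Finset (Fin m)} {U : Finset ι}
    (h : Releasable F a b g R U) {i : Fin m} (hi : i ∉ R) {y : β} (hy : ∀ j ∉ R, b j ≠ y)
    {c : ι} (hcg : c ∉ Set.range g) (hcU : c ∉ U) (hF : (a i, y) ∈ F c) :
    Releasable F a b g (insert i R) (insert c U) := by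
  intro z hz
  by_cases hzi : b i = z
  · obtain ⟨b', g', hr, hby, hb, hg⟩ := h y hy
    have hc : ∀ j, g' j ≠ c := by
      rintro j rfl
      exact (hg j).elim hcg hcU
    refine ⟨_, _, hr.update i hby hc hF, fun j => ?_, fun j hj => ?_, fun j => ?_⟩
    · by_cases hj : j = i
      · subst hj
        rw [Function.update_self, ← hzi]
        exact (hy j hi).symm
      · rw [Function.update_of_ne hj, ← hzi, ← hb i hi]
        exact hr.inj_right.ne hj
    · rw [Finset.mem_insert, not_or] at hj
      rw [Function.update_of_ne hj.1, hb j hj.2]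
    · by_cases hj : j = i
      · subst hj
        simp
      · rw [Function.update_of_ne hj]
        exact (hg j).imp_right fun hh => Finset.mem_insert_of_mem hh
  · have hz' : ∀ j ∉ R, b j ≠ z := by
      intro j hj
      by_cases hji : j = i
      · rwa [hji]
      · exact hz j (by simp [hji, hj])
    obtain ⟨b', g', hr, hbz, hb, hg⟩ := h z hz'
    refine ⟨b', g', hr, hbz, fun j hj => hb j fun hh => hj (Finset.mem_insert_of_mem hh),
      fun j => (hg j).imp_right fun hh => Finset.mem_insert_of_mem hh⟩

theorem HasMatchingOfSize.exists_not_mem {α β : Type*} {n : ℕ} {E : Set (α × β)}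
    (h : HasMatchingOfSize n E) (X : Finset α) (Y : Finset β) (hXY : X.card + Y.card < n) :
    ∃ x y, (x, y) ∈ E ∧ x ∉ X ∧ y ∉ Y := by
  classical
  obtain ⟨e, he, heE, hM⟩ := h
  have hM' : ∀ p q, p ≠ q → (e p).1 ≠ (e q).1 ∧ (e p).2 ≠ (e q).2 := fun p q hpq =>
    hM _ ⟨p, rfl⟩ _ ⟨q, rfl⟩ (he.ne hpq)
  by_contra! hcon
  have h1 : (Finset.univ.filter fun j => (e j).1 ∈ X).card ≤ X.card :=
    Finset.card_le_card_of_injOn (fun j => (e j).1) (fun j hj => by simpa using hj)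
      fun p _ q _ hpq => by_contra fun hne => (hM' p q hne).1 hpq
  have h2 : (Finset.univ.filter fun j => (e j).2 ∈ Y).card ≤ Y.card :=
    Finset.card_le_card_of_injOn (fun j => (e j).2) (fun j hj => by simpa using hj)
      fun p _ q _ hpq => by_contra fun hne => (hM' p q hne).2 hpq
  have h3 : (Finset.univ : Finset (Fin n)) ⊆
      (Finset.univ.filter fun j => (e j).1 ∈ X) ∪ (Finset.univ.filter fun j => (e j).2 ∈ Y) := by
    intro j _
    by_cases hj : (e j).1 ∈ X
    · simp [hj]
    · simp [hcon _ _ (heE j) hj]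
  have h4 := (Finset.card_le_card h3).trans (Finset.card_union_le _ _)
  rw [Finset.card_univ, Fintype.card_fin] at h4
  omega

section Extension

variable {α β ι : Type*} [Fintype ι] [DecidableEq ι] {F : ι → Set (α × β)} {m n k : ℕ}
  {a : Fin m → α} {b : Fin m → β} {g : Fin m → ι}

theorem card_unused_colours (hg : Function.Injective g) (U : Finset ι) :
    Fintype.card ι ≤ (Finset.univ.image g ∪ U)ᶜ.card + m + U.card := by
  have h1 := Finset.card_add_card_compl (Finset.univ.image g ∪ U)
  have h2 := Finset.card_union_le (Finset.univ.image g) U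
  rw [Finset.card_image_of_injective _ hg, Finset.card_univ, Fintype.card_fin] at h2
  omega

/-- In a rainbow matching which cannot be enlarged, an unused colour has no edge from an uncovered
left vertex to a right vertex that can be released. -/
theorem Releasable.mem_range_left {R : Finset (Fin m)} {U : Finset ι}
    (hRU : Releasable F a b g R U)
    (hmax : ∀ (a' : Fin (m + 1) → α) b' g', ¬ IsRainbow F a' b' g')
    {c : ι} (hc : c ∈ (Finset.univ.image g ∪ U)ᶜ) {x : α} {y : β} (hxy : (x, y) ∈ F c)
    (hy : ∀ j ∉ R, b j ≠ y) : ∃ i, a i = x := by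
  by_contra! hx
  obtain ⟨b', g', hr, hby, -, hg⟩ := hRU y hy
  have hc' : c ∉ Set.range g ∧ c ∉ U := by
    simpa [not_or] using hc
  refine hmax _ _ _ (hr.cons hx hby ?_ hxy)
  rintro j rfl
  exact (hg j).elim hc'.1 hc'.2

theorem exists_releasable (h : IsRainbow F a b g)
    (hmax : ∀ (a' : Fin (m + 1) → α) b' g', ¬ IsRainbow F a' b' g')
    (hunion : ∀ K : Finset ι, K.card = k → HasMatchingOfSize n (⋃ i ∈ K, F i))
    (hmn : m < n) (hcard : 2 * m + k ≤ Fintype.card ι + 1) (r : ℕ) (hr : r ≤ m) :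
    ∃ (R : Finset (Fin m)) (U : Finset ι), R.card = r ∧ U.card = r ∧ Releasable F a b g R U := by
  classical
  induction r with
  | zero =>
    exact ⟨∅, ∅, rfl, rfl, fun y hy =>
      ⟨b, g, h, fun j => hy j (Finset.notMem_empty j), fun _ _ => rfl, fun j => .inl ⟨j, rfl⟩⟩⟩
  | succ r ih =>
    obtain ⟨R, U, hR, hU, hRU⟩ := ih (by omega)
    have hcomp := card_unused_colours h.inj_colour U
    obtain ⟨K, hK, hKk⟩ := Finset.exists_subset_card_eq
      (show k ≤ (Finset.univ.image g ∪ U)ᶜ.card by omega)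
    have hRc := Finset.card_add_card_compl R
    rw [Fintype.card_fin] at hRc
    have hXa := Finset.card_image_le (s := R) (f := a)
    have hYb := Finset.card_image_le (s := Rᶜ) (f := b)
    obtain ⟨x, y, hxy, hx, hy⟩ :=
      (hunion K hKk).exists_not_mem (R.image a) (Rᶜ.image b) (by omega)
    simp only [Set.mem_iUnion, exists_prop] at hxy
    obtain ⟨c, hcK, hxyc⟩ := hxy
    have hy' : ∀ j ∉ R, b j ≠ y := by
      intro j hj hjy
      exact hy (Finset.mem_image.2 ⟨j, Finset.mem_compl.2 hj, hjy⟩)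
    obtain ⟨i, rfl⟩ := hRU.mem_range_left hmax (hK hcK) hxyc hy'
    have hiR : i ∉ R := fun hi => hx (Finset.mem_image_of_mem a hi)
    have hc' : c ∉ Set.range g ∧ c ∉ U := by
      simpa [not_or] using hK hcK
    refine ⟨insert i R, insert c U, ?_, ?_, hRU.insert hiR hy' hc'.1 hc'.2 hxyc⟩
    · rw [Finset.card_insert_of_notMem hiR, hR]
    · rw [Finset.card_insert_of_notMem hc'.2, hU]

theorem exists_releasable_univ (h : IsRainbow F a b g)
    (hmax : ∀ (a' : Fin (m + 1) → α) b' g', ¬ IsRainbow F a' b' g')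
    (hunion : ∀ K : Finset ι, K.card = k → HasMatchingOfSize n (⋃ i ∈ K, F i))
    (hmn : m < n) (hcard : 2 * m + k ≤ Fintype.card ι + 1) :
    ∃ U : Finset ι, Releasable F a b g Finset.univ U ∧
      k ≤ (Finset.univ.image g ∪ U)ᶜ.card + 1 := by
  obtain ⟨R, U, hR, hU, hRU⟩ := exists_releasable h hmax hunion hmn hcard m le_rfl
  obtain rfl : R = Finset.univ := Finset.eq_univ_of_card R (by rw [hR, Fintype.card_fin])
  have := card_unused_colours h.inj_colour U
  exact ⟨U, hRU, by omega⟩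

theorem IsRainbow.exists_succ (h : IsRainbow F a b g) (hk : 1 < k)
    (hne : ∀ i, (F i).Nonempty)
    (hunion : ∀ K : Finset ι, K.card = k → HasMatchingOfSize n (⋃ i ∈ K, F i))
    (hmn : m < n) (hcard : 2 * m + k ≤ Fintype.card ι + 1) :
    ∃ (a' : Fin (m + 1) → α) (b' : Fin (m + 1) → β) (g' : Fin (m + 1) → ι),
      IsRainbow F a' b' g' := by
  classical
  by_contra! hmax
  obtain ⟨U, hU, hkU⟩ := exists_releasable_univ h hmax hunion hmn hcard
  obtain ⟨d, hd⟩ : (Finset.univ.image g ∪ U)ᶜ.Nonempty := Finset.card_pos.1 (by omega)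
  have hdF : ∀ x y, (x, y) ∈ F d → ∃ i, a i = x := fun x y hxy =>
    hU.mem_range_left hmax hd hxy (by simp)
  obtain ⟨⟨x, y⟩, hxy⟩ := hne d
  obtain ⟨i, rfl⟩ := hdF x y hxy
  obtain ⟨b', g', hr, hby, -, hg⟩ := hU y (by simp)
  have hd' : d ∉ Set.range g ∧ d ∉ U := by
    simpa [not_or] using hd
  have hdg : ∀ j, g' j ≠ d := by
    rintro j rfl
    exact (hg j).elim hd'.1 hd'.2
  have hnew := hr.update i hby hdg hxy
  obtain ⟨V, hV, hkV⟩ := exists_releasable_univ hnew hmax hunion hmn hcard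
  obtain ⟨L, hL, hLk⟩ := Finset.exists_subset_card_eq
    (show k - 1 ≤ (Finset.univ.image (Function.update g' i d) ∪ V)ᶜ.card by omega)
  have hdL : d ∉ L := by
    intro hh
    have hdn := hL hh
    simp only [Finset.mem_compl, Finset.mem_union, not_or] at hdn
    exact hdn.1 (Finset.mem_image.2 ⟨i, Finset.mem_univ i, Function.update_self ..⟩)
  have ha := Finset.card_image_le (s := Finset.univ) (f := a)
  rw [Finset.card_univ, Fintype.card_fin] at ha
  obtain ⟨x, z, hxz, hx, -⟩ := (hunion (insert d L)
    (by rw [Finset.card_insert_of_notMem hdL, hLk]; omega)).exists_not_mem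
      (Finset.univ.image a) ∅ (by rw [Finset.card_empty]; omega)
  simp only [Set.mem_iUnion, exists_prop, Finset.mem_insert] at hxz
  obtain ⟨c, hc, hxzc⟩ := hxz
  obtain ⟨j, rfl⟩ : ∃ j, a j = x := by
    rcases hc with rfl | hc
    · exact hdF x z hxzc
    · exact hV.mem_range_left hmax (hL hc) hxzc (by simp)
  exact hx (Finset.mem_image_of_mem a (Finset.mem_univ j))

end Extension

/-- Main theorem: for `1 < k ≤ n`, `2n+k-3` nonempty edge sets in a bipartite
graph, the union of every `k` of which contains a matching of size `n`, have a
rainbow matching of size `n`. -/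
theorem stmt_3 {α β : Type*} (n k : ℕ) (hk : 1 < k) (hkn : k ≤ n)
    (F : Fin (2 * n + k - 3) → Set (α × β))
    (hne : ∀ i, (F i).Nonempty)
    (hunion : ∀ K : Finset (Fin (2 * n + k - 3)), K.card = k →
      HasMatchingOfSize n (⋃ i ∈ K, F i)) :
    HasRainbowMatchingOfSize n F := by
  have key : ∀ m ≤ n, ∃ (a : Fin m → α) (b : Fin m → β) (g : Fin m → Fin (2 * n + k - 3)),
      IsRainbow F a b g := by
    intro m
    induction m with
    | zero =>
      intro _
      exact ⟨Fin.elim0, Fin.elim0, Fin.elim0, fun j => j.elim0, fun j => j.elim0,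
        fun j => j.elim0, fun j => j.elim0⟩
    | succ m ih =>
      intro hm
      obtain ⟨a, b, g, h⟩ := ih (by omega)
      exact h.exists_succ hk hne hunion (by omega) (by rw [Fintype.card_fin]; omega)
  obtain ⟨a, b, g, h⟩ := key n le_rfl
  exact h.hasRainbowMatchingOfSize
end

section
/- Let C be a d-Leray simplicial complex on vertex set V, and let S_1, ..., S_{d+k} be subsets of V such that for every I ⊆ [d+k] of size k, the union of the S_i for i ∈ I is not a face of C. Then there exists a rainbow set (one element from each of some distinct S_i's, injectively chosen) that is not a face of C. -/
/-- An abstract simplicial complex on vertex set `V`: a downward closed set of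
finite sets. -/
def IsComplex {V : Type*} (C : Set (Finset V)) : Prop :=
  ∀ s ∈ C, ∀ t ⊆ s, t ∈ C

/-- The simplicial boundary of a single simplex `s` (as a formal ℤ-linear
combination of its codimension-one faces, with the usual alternating signs
determined by the linear order on the vertices). -/
noncomputable def simplexBoundary {V : Type*} [LinearOrder V] (s : Finset V) :
    Finset V →₀ ℤ :=
  ∑ i : Fin (s.sort (· ≤ ·)).length,
    ((-1 : ℤ) ^ (i : ℕ)) • Finsupp.single (s.erase ((s.sort (· ≤ ·)).get i)) 1

/-- The boundary operator on formal ℤ-linear combinations of finite subsets of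
`V`, extended linearly from `simplexBoundary`.  (Chains of vertices are sent to
multiples of the empty set, so this complex is the augmented one and computes
reduced homology.) -/
noncomputable def boundaryMap (V : Type*) [LinearOrder V] :
    (Finset V →₀ ℤ) →ₗ[ℤ] (Finset V →₀ ℤ) :=
  Finsupp.linearCombination ℤ simplexBoundary

/-- The faces of the induced subcomplex `C[W]` having exactly `m` vertices. -/
def facesIn {V : Type*} (C : Set (Finset V)) (W : Set V) (m : ℕ) :
    Set (Finset V) :=
  {s | s ∈ C ∧ ↑s ⊆ W ∧ s.card = m}

/-- A chain is supported on a set `A` of simplices. -/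
def SupportedOn {V : Type*} (A : Set (Finset V)) (x : Finset V →₀ ℤ) : Prop :=
  ∀ s, x s ≠ 0 → s ∈ A

/-- The reduced simplicial homology `H̃_j(C[W];ℤ)` vanishes: every `j`-cycle of
the induced subcomplex `C[W]` is the boundary of a `(j+1)`-chain of `C[W]`.
(A `j`-dimensional simplex has `j+1` vertices; since the chain complex is
augmented, the `j = 0` case is the reduced one.) -/
def ReducedHomologyVanishes {V : Type*} [LinearOrder V] (C : Set (Finset V))
    (W : Set V) (j : ℕ) : Prop :=
  ∀ x : Finset V →₀ ℤ, SupportedOn (facesIn C W (j + 1)) x →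
    boundaryMap V x = 0 →
      ∃ y : Finset V →₀ ℤ, SupportedOn (facesIn C W (j + 2)) y ∧
        boundaryMap V y = x

/-- `C` is `d`-Leray: all reduced homology groups `H̃_j(C[W];ℤ)` with `j ≥ d`
of all induced subcomplexes vanish. -/
def IsLeray {V : Type*} [LinearOrder V] (d : ℕ) (C : Set (Finset V)) : Prop :=
  ∀ (W : Set V) (j : ℕ), d ≤ j → ReducedHomologyVanishes C W j

/-- The sign `(-1) ^ #{w ∈ s | w < v}` of the vertex `v` relative to the simplex `s`. -/
def vertexSign {V : Type*} [LinearOrder V] (v : V) (s : Finset V) : ℤ :=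
  (-1) ^ (s.filter (· < v)).card

section Signs

variable {V : Type*} [LinearOrder V]

lemma vertexSign_mul_self (v : V) (s : Finset V) : vertexSign v s * vertexSign v s = 1 := by
  unfold vertexSign
  rw [← pow_add, ← two_mul, pow_mul]
  simp

lemma vertexSign_erase_self (v : V) (s : Finset V) :
    vertexSign v (s.erase v) = vertexSign v s := by
  unfold vertexSign
  congr 2
  ext w
  simp only [Finset.mem_filter, Finset.mem_erase]
  exact ⟨fun h => ⟨h.1.2, h.2⟩, fun h => ⟨⟨h.2.ne, h.1⟩, h.2⟩⟩

lemma vertexSign_insert_self (v : V) (s : Finset V) :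
    vertexSign v (insert v s) = vertexSign v s := by
  rw [← vertexSign_erase_self v (insert v s), ← vertexSign_erase_self v s,
    Finset.erase_insert_eq_erase]

lemma vertexSign_insert {w : V} {s : Finset V} (hw : w ∉ s) (v : V) :
    vertexSign v (insert w s) = (if w < v then -1 else 1) * vertexSign v s := by
  unfold vertexSign
  rw [Finset.filter_insert]
  split_ifs with h
  · rw [Finset.card_insert_of_notMem (by simp [hw]), pow_succ]
    ring
  · simp

lemma vertexSign_erase_swap {s : Finset V} {v w : V} (hv : v ∈ s) (hw : w ∈ s) (hvw : v ≠ w) :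
    vertexSign v s * vertexSign w (s.erase v) = -(vertexSign w s * vertexSign v (s.erase w)) := by
  obtain ⟨t, ht⟩ : ∃ t, t = (s.erase v).erase w := ⟨_, rfl⟩
  have hvt : v ∉ t := by simp [ht]
  have hwt : w ∉ t := by simp [ht]
  have hs : s = insert v (insert w t) := by
    rw [ht, Finset.insert_erase (by simp [hw, hvw.symm]), Finset.insert_erase hv]
  have hsv : s.erase v = insert w t := by
    rw [hs, Finset.erase_insert (by simp [hvw, hvt])]
  have hsw : s.erase w = insert v t := by
    rw [hs, Finset.insert_comm, Finset.erase_insert (by simp [hvw.symm, hwt])]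
  rw [hsv, hsw, hs, vertexSign_insert_self, vertexSign_insert_self,
    Finset.insert_comm, vertexSign_insert_self, vertexSign_insert_self,
    vertexSign_insert hwt, vertexSign_insert hvt]
  rcases lt_or_gt_of_ne hvw with h | h
  · simp [h, h.le.not_gt]; ring
  · simp [h, h.le.not_gt]; ring

lemma vertexSign_insert_erase {s : Finset V} {v w : V} (hv : v ∉ s) (hw : w ∈ s) :
    vertexSign v s * vertexSign w (insert v s) = -(vertexSign w s * vertexSign v (s.erase w)) := by
  have hvw : v ≠ w := fun h => hv (h ▸ hw)
  have h := vertexSign_erase_swap (s := insert v s) (Finset.mem_insert_self v s)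
    (Finset.mem_insert_of_mem hw) hvw
  rw [Finset.erase_insert hv, vertexSign_insert_self, Finset.erase_insert_of_ne hvw,
    vertexSign_insert_self] at h
  have h1 := vertexSign_mul_self w s
  have h2 := vertexSign_mul_self w (insert v s)
  have h3 : vertexSign v s =
      -(vertexSign w (insert v s) * vertexSign v (s.erase w)) * vertexSign w s := by
    rw [← h, mul_assoc, h1, mul_one]
  rw [h3]
  linear_combination (-vertexSign v (s.erase w) * vertexSign w s) * h2

end Signs

section Boundary

variable {V : Type*} [LinearOrder V]

lemma simplexBoundary_eq_sum (s : Finset V) :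
    simplexBoundary s = ∑ v ∈ s, vertexSign v s • Finsupp.single (s.erase v) 1 := by
  unfold simplexBoundary
  refine Finset.sum_bij (fun i _ => (s.sort (· ≤ ·)).get i) ?_ ?_ ?_ ?_
  · intro i _
    exact (Finset.mem_sort (· ≤ ·)).1 (List.get_mem _ _)
  · intro i _ j _ h
    exact (Finset.sort_nodup s (· ≤ ·)).injective_get h
  · intro v hv
    obtain ⟨i, hi⟩ := List.get_of_mem ((Finset.mem_sort (· ≤ ·)).2 hv)
    exact ⟨i, Finset.mem_univ _, hi⟩
  · intro i _
    congr 1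
    unfold vertexSign
    congr 1
    have hmono : StrictMono (s.sort (· ≤ ·)).get := (Finset.sortedLT_sort s).strictMono_get
    have : s.filter (· < (s.sort (· ≤ ·)).get i) =
        (Finset.univ.filter (· < i)).image (s.sort (· ≤ ·)).get := by
      ext w
      simp only [Finset.mem_filter, Finset.mem_image, Finset.mem_univ, true_and]
      constructor
      · rintro ⟨hw, hlt⟩
        obtain ⟨j, rfl⟩ := List.get_of_mem ((Finset.mem_sort (· ≤ ·)).2 hw)
        exact ⟨j, hmono.lt_iff_lt.1 hlt, rfl⟩
      · rintro ⟨j, hj, rfl⟩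
        exact ⟨(Finset.mem_sort (· ≤ ·)).1 (List.get_mem _ _), hmono hj⟩
    rw [this, Finset.card_image_of_injective _ hmono.injective]
    rw [Finset.filter_gt_eq_Iio, Fin.card_Iio]

lemma boundaryMap_single (s : Finset V) :
    boundaryMap V (Finsupp.single s 1) =
      ∑ v ∈ s, vertexSign v s • Finsupp.single (s.erase v) 1 := by
  simp [boundaryMap, simplexBoundary_eq_sum]

/-- Exterior multiplication by the vertex `v`. -/
noncomputable def coneMap (v : V) : (Finset V →₀ ℤ) →ₗ[ℤ] (Finset V →₀ ℤ) :=
  Finsupp.linearCombination ℤ fun s =>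
    if v ∈ s then 0 else vertexSign v s • Finsupp.single (insert v s) 1

lemma coneMap_single_of_mem {v : V} {s : Finset V} (h : v ∈ s) :
    coneMap v (Finsupp.single s 1) = 0 := by
  simp [coneMap, h]

lemma coneMap_single_of_notMem {v : V} {s : Finset V} (h : v ∉ s) :
    coneMap v (Finsupp.single s 1) = vertexSign v s • Finsupp.single (insert v s) 1 := by
  simp only [coneMap, Finsupp.linearCombination_single, one_smul, if_neg h]

lemma boundaryMap_coneMap_single (v : V) (s : Finset V) :
    boundaryMap V (coneMap v (Finsupp.single s 1)) =
      Finsupp.single s 1 - coneMap v (boundaryMap V (Finsupp.single s 1)) := by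
  by_cases hv : v ∈ s
  · rw [coneMap_single_of_mem hv, boundaryMap_single, map_sum, Finset.sum_eq_single_of_mem v hv,
      map_smul, coneMap_single_of_notMem (Finset.notMem_erase v s), smul_smul,
      vertexSign_erase_self, vertexSign_mul_self, Finset.insert_erase hv]
    · simp
    · intro w _ hw
      rw [map_smul, coneMap_single_of_mem (by simp [hv, hw.symm]), smul_zero]
  · rw [coneMap_single_of_notMem hv, map_smul, boundaryMap_single, boundaryMap_single,
      Finset.sum_insert hv, smul_add, smul_smul, vertexSign_insert_self, vertexSign_mul_self,
      Finset.erase_insert hv, one_smul, sub_eq_add_neg, map_sum, Finset.smul_sum,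
      ← Finset.sum_neg_distrib]
    congr 1
    refine Finset.sum_congr rfl fun w hw => ?_
    rw [map_smul, coneMap_single_of_notMem (fun h => hv (Finset.mem_of_mem_erase h)), smul_smul,
      smul_smul, vertexSign_insert_erase hv hw,
      Finset.erase_insert_of_ne (ne_of_mem_of_not_mem hw hv).symm, neg_smul]

lemma boundaryMap_coneMap (v : V) (x : Finset V →₀ ℤ) :
    boundaryMap V (coneMap v x) = x - coneMap v (boundaryMap V x) := by
  have : (boundaryMap V).comp (coneMap v) = LinearMap.id - (coneMap v).comp (boundaryMap V) := by
    refine Finsupp.lhom_ext' fun s => LinearMap.ext_ring ?_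
    simpa using boundaryMap_coneMap_single v s
  exact LinearMap.congr_fun this x

lemma coneMap_mem_supported {v : V} {A B : Set (Finset V)}
    (h : ∀ s ∈ A, v ∉ s → insert v s ∈ B) {x : Finset V →₀ ℤ}
    (hx : x ∈ Finsupp.supported ℤ ℤ A) : coneMap v x ∈ Finsupp.supported ℤ ℤ B := by
  rw [coneMap, Finsupp.linearCombination_apply]
  refine Submodule.sum_mem _ fun s hs => Submodule.smul_mem _ _ ?_
  split_ifs with hv
  · exact Submodule.zero_mem _
  · exact Submodule.smul_mem _ _ (Finsupp.single_mem_supported ℤ _ (h s (hx hs) hv))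

lemma boundaryMap_single_apply {U s : Finset V} (hs : s ⊆ U) (t : Finset V) :
    boundaryMap V (Finsupp.single s 1) t =
      ∑ v ∈ U \ t, vertexSign v t * Finsupp.single s (1 : ℤ) (insert v t) := by
  rw [boundaryMap_single, Finsupp.finsetSum_apply]
  simp only [Finsupp.smul_apply, Finsupp.single_apply, smul_eq_mul, mul_ite, mul_one, mul_zero]
  rw [← Finset.sum_filter, ← Finset.sum_filter]
  have : s.filter (fun v => s.erase v = t) = (U \ t).filter (fun v => s = insert v t) := by
    ext v
    simp only [Finset.mem_filter, Finset.mem_sdiff]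
    constructor
    · rintro ⟨hv, rfl⟩
      exact ⟨⟨hs hv, Finset.notMem_erase v s⟩, (Finset.insert_erase hv).symm⟩
    · rintro ⟨⟨-, hv⟩, rfl⟩
      exact ⟨Finset.mem_insert_self v t, Finset.erase_insert hv⟩
  rw [this]
  refine Finset.sum_congr rfl fun v hv => ?_
  rw [(Finset.mem_filter.1 hv).2, vertexSign_insert_self]

lemma boundaryMap_apply {U : Finset V} {x : Finset V →₀ ℤ}
    (hx : x ∈ Finsupp.supported ℤ ℤ {s | s ⊆ U}) (t : Finset V) :
    boundaryMap V x t = ∑ v ∈ U \ t, vertexSign v t * x (insert v t) := by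
  rw [Finsupp.supported_eq_span_single] at hx
  induction hx using Submodule.span_induction with
  | mem x hx =>
    obtain ⟨s, hs, rfl⟩ := hx
    exact boundaryMap_single_apply hs t
  | zero => simp
  | add x y _ _ hx hy => simp [hx, hy, mul_add, Finset.sum_add_distrib]
  | smul a x _ hx =>
    simp only [map_smul, Finsupp.smul_apply, smul_eq_mul, hx, Finset.mul_sum]
    exact Finset.sum_congr rfl fun v _ => by ring

end Boundary

section CubicalFamily

variable {V N : Type*} [LinearOrder V] [AddCommGroup N]

/-- The cubical boundary of the cell `[ρ, ρ ∪ π]`, evaluated on a family `F` of chains and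
augmented by `o` on vertices. -/
def cubeBoundary (o : N) (F : Finset V → Finset V → N) (ρ π : Finset V) : N :=
  (if π = ∅ then o else 0) +
    ∑ v ∈ π, vertexSign v π • (F ρ (π.erase v) - F (insert v ρ) (π.erase v))

/-- `F` assigns to each cell `[ρ, ρ ∪ π]` of the complex `X` of dimension less than `m` a chain
in the carrier `A ρ`, compatibly with the cubical boundary. -/
def IsCubicalFamily (X : Set (Finset V)) (D : N →+ N) (o : N) (A : Finset V → ℕ → AddSubgroup N)
    (F : Finset V → Finset V → N) (m : ℕ) : Prop :=
  ∀ ρ π, Disjoint ρ π → ρ ∪ π ∈ X → π.card < m →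
    F ρ π ∈ A ρ (π.card + 1) ∧ D (F ρ π) = cubeBoundary o F ρ π

lemma sum_erase_antisymm (π : Finset V) (G : V → V → N) (hG : ∀ v w, G v w = G w v) :
    ∑ v ∈ π, vertexSign v π • ∑ w ∈ π.erase v, vertexSign w (π.erase v) • G v w = 0 := by
  simp only [Finset.smul_sum, smul_smul]
  rw [Finset.sum_sigma']
  refine Finset.sum_involution (fun p _ => ⟨p.2, p.1⟩) ?_ ?_ ?_ ?_
  · rintro ⟨v, w⟩ h
    simp only [Finset.mem_sigma, Finset.mem_erase] at h
    simp only
    rw [vertexSign_erase_swap h.1 h.2.2 (Ne.symm h.2.1), hG v w, neg_smul, neg_add_cancel]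
  · rintro ⟨v, w⟩ h - h'
    simp only [Finset.mem_sigma, Finset.mem_erase] at h
    simp only [Sigma.mk.injEq] at h'
    exact h.2.1 h'.1
  · rintro ⟨v, w⟩ h
    simp only [Finset.mem_sigma, Finset.mem_erase] at h ⊢
    exact ⟨h.2.2, Ne.symm h.2.1, h.1⟩
  · rintro ⟨v, w⟩ h
    rfl

variable {X : Set (Finset V)} {D : N →+ N} {o : N} {A : Finset V → ℕ → AddSubgroup N}
  {F : Finset V → Finset V → N} {m : ℕ}

lemma IsCubicalFamily.map_cubeBoundary (hX : IsComplex X) (ho : D o = 0)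
    (hF : IsCubicalFamily X D o A F m) {ρ π : Finset V} (hd : Disjoint ρ π) (hρπ : ρ ∪ π ∈ X)
    (hπ : π.card ≤ m) : D (cubeBoundary o F ρ π) = 0 := by
  have key : ∀ v ∈ π, D (F ρ (π.erase v) - F (insert v ρ) (π.erase v)) =
      ∑ w ∈ π.erase v, vertexSign w (π.erase v) •
        (F ρ ((π.erase v).erase w) - F (insert w ρ) ((π.erase v).erase w) -
          (F (insert v ρ) ((π.erase v).erase w) -
            F (insert w (insert v ρ)) ((π.erase v).erase w))) := by
    intro v hv
    have hc : (π.erase v).card < m := by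
      have := Finset.card_erase_lt_of_mem hv
      omega
    have h1 := hF ρ (π.erase v) (hd.mono_right (Finset.erase_subset _ _))
      (hX _ hρπ _ (Finset.union_subset_union_right (Finset.erase_subset _ _))) hc
    have h2 := hF (insert v ρ) (π.erase v)
      (Finset.disjoint_insert_left.2
        ⟨Finset.notMem_erase v π, hd.mono_right (Finset.erase_subset _ _)⟩)
      (hX _ hρπ _ (by
        intro x hx
        simp only [Finset.mem_union, Finset.mem_insert, Finset.mem_erase] at hx ⊢
        rcases hx with (rfl | hx) | hx
        · exact Or.inr hv
        · exact Or.inl hx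
        · exact Or.inr hx.2)) hc
    rw [map_sub, h1.2, h2.2, cubeBoundary, cubeBoundary, add_sub_add_left_eq_sub,
      ← Finset.sum_sub_distrib]
    exact Finset.sum_congr rfl fun w _ => (smul_sub _ _ _).symm
  rw [cubeBoundary, map_add, map_sum]
  have h0 : D (if π = ∅ then o else 0) = 0 := by split_ifs <;> simp [ho]
  rw [h0, zero_add]
  refine (Finset.sum_congr rfl fun v hv => by rw [map_zsmul, key v hv]).trans
    (sum_erase_antisymm π (fun v w => F ρ ((π.erase v).erase w) -
      F (insert w ρ) ((π.erase v).erase w) - (F (insert v ρ) ((π.erase v).erase w) -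
        F (insert w (insert v ρ)) ((π.erase v).erase w))) fun v w => ?_)
  simp only [Finset.erase_right_comm (a := w) (b := v), Finset.insert_comm w v]
  abel

lemma IsCubicalFamily.cubeBoundary_mem (hX : IsComplex X) (hA : ∀ ρ v q, A (insert v ρ) q ≤ A ρ q)
    (hoA : ∀ ρ, o ∈ A ρ 0) (hF : IsCubicalFamily X D o A F m) {ρ π : Finset V}
    (hd : Disjoint ρ π) (hρπ : ρ ∪ π ∈ X) (hπ : π.card ≤ m) :
    cubeBoundary o F ρ π ∈ A ρ π.card := by
  refine add_mem ?_ (sum_mem fun v hv => zsmul_mem (sub_mem ?_ ?_) _)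
  · split_ifs with h
    · simpa [h] using hoA ρ
    · exact zero_mem _
  · have hc := Finset.card_erase_add_one hv
    rw [← hc]
    exact (hF ρ (π.erase v) (hd.mono_right (Finset.erase_subset _ _))
      (hX _ hρπ _ (Finset.union_subset_union_right (Finset.erase_subset _ _))) (by omega)).1
  · have hc := Finset.card_erase_add_one hv
    rw [← hc]
    refine hA ρ v _ (hF (insert v ρ) (π.erase v)
      (Finset.disjoint_insert_left.2
        ⟨Finset.notMem_erase v π, hd.mono_right (Finset.erase_subset _ _)⟩)
      (hX _ hρπ _ ?_) (by omega)).1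
    intro x hx
    simp only [Finset.mem_union, Finset.mem_insert, Finset.mem_erase] at hx ⊢
    rcases hx with (rfl | hx) | hx
    · exact Or.inr hv
    · exact Or.inl hx
    · exact Or.inr hx.2

lemma cubeBoundary_congr {F' : Finset V → Finset V → N} {ρ π : Finset V}
    (h : ∀ ρ' π' : Finset V, π'.card < π.card → F ρ' π' = F' ρ' π') :
    cubeBoundary o F ρ π = cubeBoundary o F' ρ π := by
  unfold cubeBoundary
  congr 1
  refine Finset.sum_congr rfl fun v hv => ?_
  rw [h _ _ (Finset.card_erase_lt_of_mem hv), h _ _ (Finset.card_erase_lt_of_mem hv)]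

lemma IsCubicalFamily.exists_succ (hX : IsComplex X) (ho : D o = 0)
    (hA : ∀ ρ v q, A (insert v ρ) q ≤ A ρ q) (hoA : ∀ ρ, o ∈ A ρ 0)
    (hF : IsCubicalFamily X D o A F m)
    (hfill : ∀ ρ ∈ X, ∀ z ∈ A ρ m, D z = 0 → ∃ y ∈ A ρ (m + 1), D y = z) :
    ∃ F', IsCubicalFamily X D o A F' (m + 1) := by
  classical
  have hex : ∀ ρ π, ∃ y, Disjoint ρ π → ρ ∪ π ∈ X → π.card = m →
      y ∈ A ρ (m + 1) ∧ D y = cubeBoundary o F ρ π := by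
    intro ρ π
    by_cases h : Disjoint ρ π ∧ ρ ∪ π ∈ X ∧ π.card = m
    · obtain ⟨hd, hρπ, hπ⟩ := h
      obtain ⟨y, hy⟩ := hfill ρ (hX _ hρπ _ Finset.subset_union_left) (cubeBoundary o F ρ π)
        (by simpa [hπ] using hF.cubeBoundary_mem hX hA hoA hd hρπ hπ.le)
        (hF.map_cubeBoundary hX ho hd hρπ hπ.le)
      exact ⟨y, fun _ _ _ => hy⟩
    · exact ⟨0, fun h1 h2 h3 => (h ⟨h1, h2, h3⟩).elim⟩
  choose G hG using hex
  refine ⟨fun ρ π => if π.card < m then F ρ π else G ρ π, fun ρ π hd hρπ hπ => ?_⟩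
  have hlt : ∀ ρ' π' : Finset V, π'.card < π.card →
      F ρ' π' = if π'.card < m then F ρ' π' else G ρ' π' := by
    intro ρ' π' h
    rw [if_pos (by omega)]
  rw [← cubeBoundary_congr hlt]
  by_cases h : π.card < m
  · simp only [if_pos h]
    exact hF ρ π hd hρπ h
  · have hm : π.card = m := by omega
    simp only [if_neg h]
    simpa [hm] using hG ρ π hd hρπ hm

lemma IsCubicalFamily.exists_of_le (hX : IsComplex X) (ho : D o = 0)
    (hA : ∀ ρ v q, A (insert v ρ) q ≤ A ρ q) (hoA : ∀ ρ, o ∈ A ρ 0)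
    (hF : IsCubicalFamily X D o A F m) {b : ℕ} (hb : m ≤ b)
    (hfill : ∀ q, m ≤ q → q < b → ∀ ρ ∈ X, ∀ z ∈ A ρ q, D z = 0 → ∃ y ∈ A ρ (q + 1), D y = z) :
    ∃ F', IsCubicalFamily X D o A F' b := by
  induction b, hb using Nat.le_induction with
  | base => exact ⟨F, hF⟩
  | succ b hb ih =>
    obtain ⟨F', hF'⟩ := ih fun q h1 h2 => hfill q h1 (by omega)
    exact hF'.exists_succ hX ho hA hoA (hfill b hb (by omega))

lemma IsCubicalFamily.map {M : Type*} [AddCommGroup M] {D' : M →+ M}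
    {A' : Finset V → ℕ → AddSubgroup M} (hF : IsCubicalFamily X D o A F m) (p : N →+ M)
    (hp : ∀ x, D' (p x) = p (D x))
    (hA : ∀ ρ ∈ X, ∀ q, ∀ x ∈ A ρ q, p x ∈ A' ρ q) (hX : IsComplex X) :
    IsCubicalFamily X D' (p o) A' (fun ρ π => p (F ρ π)) m := by
  intro ρ π hd hρπ hπ
  obtain ⟨h1, h2⟩ := hF ρ π hd hρπ hπ
  refine ⟨hA _ (hX _ hρπ _ Finset.subset_union_left) _ _ h1, ?_⟩
  rw [hp, h2, cubeBoundary, cubeBoundary, map_add, map_sum, apply_ite p, map_zero]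
  simp only [map_zsmul, map_sub]

end CubicalFamily

section Rainbow

universe u w

variable {V ι : Type*}

/-- `τ` is a partial transversal of the sets `S i`, `i ∈ J`. -/
def IsRainbow_s5 (S : ι → Finset V) (J : Finset ι) (τ : Finset V) : Prop :=
  ∃ f : V → ι, Set.InjOn f τ ∧ ∀ x ∈ τ, f x ∈ J ∧ x ∈ S (f x)

lemma IsRainbow_s5.mono {S : ι → Finset V} {J J' : Finset ι} (h : J ⊆ J') {τ : Finset V}
    (hτ : IsRainbow_s5 S J τ) : IsRainbow_s5 S J' τ := by
  obtain ⟨f, hf, hf'⟩ := hτ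
  exact ⟨f, hf, fun x hx => ⟨h (hf' x hx).1, (hf' x hx).2⟩⟩

variable [LinearOrder V]

lemma IsRainbow_s5.insert [DecidableEq ι] {S : ι → Finset V} {J : Finset ι} {i : ι} (hi : i ∉ J)
    {τ : Finset V} (hτ : IsRainbow_s5 S J τ) {v : V} (hv : v ∈ S i) (hvτ : v ∉ τ) :
    IsRainbow_s5 S (insert i J) (insert v τ) := by
  obtain ⟨f, hf, hf'⟩ := hτ
  have hne : ∀ x ∈ τ, Function.update f v i x = f x := fun x hx =>
    Function.update_of_ne (ne_of_mem_of_not_mem hx hvτ) _ _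
  refine ⟨Function.update f v i, ?_, ?_⟩
  · rw [Finset.coe_insert, Set.injOn_insert (by simpa using hvτ)]
    refine ⟨fun x hx y hy hxy => ?_, ?_⟩
    · rw [hne x hx, hne y hy] at hxy
      exact hf hx hy hxy
    · rintro ⟨x, hx, hxi⟩
      rw [hne x hx, Function.update_self] at hxi
      exact hi (hxi ▸ (hf' x hx).1)
  · intro x hx
    rcases Finset.mem_insert.1 hx with rfl | hx
    · simp [hv]
    · rw [hne x hx]
      exact ⟨Finset.mem_insert_of_mem (hf' x hx).1, (hf' x hx).2⟩

/-- The chain complex of the join of the discrete sets `S i`, `i ∈ J`, with its chain map to the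
chains of `V`. Here `A ρ q` consists of the chains with `q` vertices, all outside `ρ`. -/
structure JoinComplex (S : ι → Finset V) (J : Finset ι) (N : Type*) [AddCommGroup N] where
  /-- The boundary operator. -/
  D : N →+ N
  /-- The empty simplex. -/
  o : N
  /-- The chains of given degree avoiding a given set of vertices. -/
  A : Finset V → ℕ → AddSubgroup N
  /-- The map to the chains of `V`. -/
  p : N →+ (Finset V →₀ ℤ)
  D_o : D o = 0
  p_o : p o = Finsupp.single ∅ 1
  p_D : ∀ x, boundaryMap V (p x) = p (D x)
  o_mem : ∀ ρ, o ∈ A ρ 0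
  A_anti : ∀ ρ v q, A (insert v ρ) q ≤ A ρ q
  p_mem : ∀ ρ q, ∀ x ∈ A ρ q,
    p x ∈ Finsupp.supported ℤ ℤ {τ | IsRainbow_s5 S J τ ∧ Disjoint τ ρ ∧ τ.card = q}
  fill : ∀ ρ q, q < (J.filter fun i => ¬ S i ⊆ ρ).card →
    ∀ z ∈ A ρ q, D z = 0 → ∃ y ∈ A ρ (q + 1), D y = z

lemma JoinComplex.exists_empty [Nonempty ι] (S : ι → Finset V) :
    Nonempty (JoinComplex S ∅ (Finset V →₀ ℤ)) := by
  refine ⟨{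
    D := (boundaryMap V).toAddMonoidHom
    o := Finsupp.single ∅ 1
    A := fun _ q => (Finsupp.supported ℤ ℤ {τ : Finset V | τ = ∅ ∧ q = 0}).toAddSubgroup
    p := AddMonoidHom.id _
    D_o := by simp [boundaryMap_single]
    p_o := rfl
    p_D := fun _ => rfl
    o_mem := fun ρ => Finsupp.single_mem_supported ℤ _ ⟨rfl, rfl⟩
    A_anti := fun _ _ _ => le_rfl
    p_mem := fun ρ q x hx => Finsupp.supported_mono ?_ hx
    fill := by simp }⟩
  rintro _ ⟨rfl, rfl⟩
  exact ⟨⟨fun _ => Classical.arbitrary ι, by simp, by simp⟩, by simp, rfl⟩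

/-- The chains `b` with `v * b` a chain in the carrier `A ρ` enlarged by cones. -/
def coneCarrier {N : Type*} [AddCommGroup N] (A : Finset V → ℕ → AddSubgroup N) (ρ : Finset V)
    (v : V) : ℕ → AddSubgroup N
  | 0 => ⊥
  | q + 1 => if v ∈ ρ then ⊥ else A ρ q

lemma mem_coneCarrier {N : Type*} [AddCommGroup N] {A : Finset V → ℕ → AddSubgroup N}
    {ρ : Finset V} {v : V} {q : ℕ} {b : N} :
    b ∈ coneCarrier A ρ v q ↔ b = 0 ∨ v ∉ ρ ∧ ∃ r, q = r + 1 ∧ b ∈ A ρ r := by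
  cases q with
  | zero => simp [coneCarrier]
  | succ q =>
    by_cases hv : v ∈ ρ
    · simp [coneCarrier, hv]
    · simp only [coneCarrier, hv, if_false, not_false_eq_true, true_and, Nat.add_right_cancel_iff,
        exists_eq_left']
      exact ⟨Or.inr, fun h => h.elim (fun h => h ▸ zero_mem _) id⟩

lemma JoinComplex.exists_insert [DecidableEq ι] {S : ι → Finset V} {J : Finset ι}
    {N : Type*} [AddCommGroup N] (K : JoinComplex S J N) {i : ι} (hi : i ∉ J) :
    Nonempty (JoinComplex S (insert i J) (N × ({x // x ∈ S i} → N))) := by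
  classical
  refine ⟨{
    D := ((K.D.comp (AddMonoidHom.fst _ _)) +
      ∑ v, (Pi.evalAddMonoidHom _ v).comp (AddMonoidHom.snd _ _)).prod
        (-(K.D.compLeft _).comp (AddMonoidHom.snd _ _))
    o := (K.o, 0)
    A := fun ρ q => (K.A ρ q).prod
      (AddSubgroup.pi Set.univ fun v => coneCarrier K.A ρ v.1 q)
    p := K.p.comp (AddMonoidHom.fst _ _) + ∑ v, (coneMap v.1).toAddMonoidHom.comp
      (K.p.comp ((Pi.evalAddMonoidHom _ v).comp (AddMonoidHom.snd _ _)))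
    D_o := by ext <;> simp [K.D_o]
    p_o := by simp [K.p_o]
    p_D := ?_
    o_mem := fun ρ => ⟨K.o_mem ρ, fun _ _ => mem_coneCarrier.2 (Or.inl rfl)⟩
    A_anti := ?_
    p_mem := ?_
    fill := ?_ }⟩
  · rintro ⟨a, b⟩
    simp [AddMonoidHom.finsetSum_apply, K.p_D, boundaryMap_coneMap, add_assoc, sub_eq_add_neg,
      Finset.sum_add_distrib]
  · rintro ρ v q ⟨a, b⟩ ⟨ha, hb⟩
    refine ⟨K.A_anti ρ v q ha, fun w _ => mem_coneCarrier.2 ?_⟩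
    obtain h0 | ⟨hw, r, hr, hbr⟩ := mem_coneCarrier.1 (hb w trivial)
    · exact Or.inl h0
    · exact Or.inr ⟨fun h => hw (Finset.mem_insert_of_mem h), r, hr, K.A_anti ρ v r hbr⟩
  · rintro ρ q ⟨a, b⟩ ⟨ha, hb⟩
    simp only [AddMonoidHom.add_apply, AddMonoidHom.finsetSum_apply]
    refine add_mem (Finsupp.supported_mono ?_ (K.p_mem ρ q a ha)) (sum_mem fun v _ => ?_)
    · rintro τ ⟨h1, h2⟩
      exact ⟨h1.mono (Finset.subset_insert _ _), h2⟩
    · obtain h0 | ⟨hv, r, rfl, hbr⟩ := mem_coneCarrier.1 (hb v trivial)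
      · have h0 : b v = 0 := h0
        simp [h0]
      · refine coneMap_mem_supported ?_ (K.p_mem ρ r _ hbr)
        rintro τ ⟨h1, h2, h3⟩ hvτ
        exact ⟨h1.insert hi v.2 hvτ, Finset.disjoint_insert_left.2 ⟨hv, h2⟩,
          by rw [Finset.card_insert_of_notMem hvτ, h3]⟩
  · rintro ρ q hq ⟨a, b⟩ ⟨ha, hb⟩ hD
    replace hb : ∀ v, b v ∈ coneCarrier K.A ρ v.1 q := fun v => hb v trivial
    have hD1 : K.D a + ∑ v, b v = 0 := by
      simpa [AddMonoidHom.finsetSum_apply] using congrArg Prod.fst hD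
    have hD2 : ∀ v, K.D (b v) = 0 := fun v => by
      simpa using congrFun (congrArg Prod.snd hD) v
    rw [Finset.filter_insert] at hq
    by_cases hS : S i ⊆ ρ
    · have hb0 : b = 0 := funext fun v =>
        (mem_coneCarrier.1 (hb v)).resolve_right fun h => h.1 (hS v.2)
      obtain ⟨y, hy, hyD⟩ := K.fill ρ q (by simpa [hS] using hq) a ha (by simpa [hb0] using hD1)
      exact ⟨(y, 0), ⟨hy, fun _ _ => mem_coneCarrier.2 (Or.inl rfl)⟩,
        by ext <;> simp [hyD, hb0]⟩
    · obtain ⟨u, hu, huρ⟩ := Finset.not_subset.1 hS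
      rw [if_pos hS, Finset.card_insert_of_notMem (by simp [hi])] at hq
      have hc : ∀ v, ∃ c ∈ K.A ρ q, (v.1 ∈ ρ → c = 0) ∧ K.D c = b v := by
        intro v
        obtain h0 | ⟨hv, r, rfl, hbr⟩ := mem_coneCarrier.1 (hb v)
        · exact ⟨0, zero_mem _, fun _ => rfl, by simp [h0]⟩
        · obtain ⟨c, hc, hcD⟩ := K.fill ρ r (by omega) _ hbr (hD2 v)
          exact ⟨c, hc, fun h => (hv h).elim, hcD⟩
      choose c hcA hc0 hcD using hc
      obtain ⟨e, he⟩ : ∃ e, e = a + ∑ v, c v := ⟨_, rfl⟩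
      have hDe : K.D e = 0 := by
        rw [he, map_add, map_sum]
        simpa only [hcD] using hD1
      have heA : e ∈ K.A ρ q := he ▸ add_mem ha (sum_mem fun v _ => hcA v)
      refine ⟨(0, Pi.single ⟨u, hu⟩ e - c),
        ⟨zero_mem _, fun v _ => mem_coneCarrier.2 ?_⟩, Prod.ext ?_ (funext fun v => ?_)⟩
      · by_cases hv : v.1 ∈ ρ
        · have hvu : v ≠ ⟨u, hu⟩ := fun h => huρ (by simpa [h] using hv)
          exact Or.inl (by simp [hc0 v hv, hvu])
        · refine Or.inr ⟨hv, q, rfl, sub_mem ?_ (hcA v)⟩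
          obtain rfl | hvu := eq_or_ne v ⟨u, hu⟩
          · simpa using heA
          · simp [hvu, zero_mem]
      · simp [AddMonoidHom.finsetSum_apply, he]
      · obtain rfl | hvu := eq_or_ne v ⟨u, hu⟩
        · simp [hDe, hcD]
        · simp [hvu, hcD]

theorem JoinComplex.exists_type {V : Type u} {ι : Type w} [LinearOrder V] [DecidableEq ι]
    [Nonempty ι] (S : ι → Finset V) (J : Finset ι) :
    ∃ (N : Type u) (_ : AddCommGroup N), Nonempty (JoinComplex S J N) := by
  induction J using Finset.induction_on with
  | empty => exact ⟨_, _, JoinComplex.exists_empty S⟩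
  | insert i J hi ih =>
    obtain ⟨N, _, ⟨K⟩⟩ := ih
    exact ⟨_, _, K.exists_insert hi⟩

end Rainbow

section Trace

variable {V : Type*}

/-- The complex of faces of `C` inside the finite set `U`. -/
def restrictComplex (C : Set (Finset V)) (U : Finset V) : Set (Finset V) :=
  {s | s ∈ C ∧ s ⊆ U}

lemma restrictComplex.isComplex {C : Set (Finset V)} (hC : IsComplex C) (U : Finset V) :
    IsComplex (restrictComplex C U) :=
  fun _ hs _ ht => ⟨hC _ hs.1 _ ht, ht.trans hs.2⟩

variable [LinearOrder V]

/-- The chains with `q` vertices of the subcomplex of `C` induced on `U \ ρ`. -/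
noncomputable def chainsAvoiding (C : Set (Finset V)) (U ρ : Finset V) (q : ℕ) :
    AddSubgroup (Finset V →₀ ℤ) :=
  (Finsupp.supported ℤ ℤ (facesIn C (↑(U \ ρ)) q)).toAddSubgroup

lemma mem_chainsAvoiding {C : Set (Finset V)} {U ρ : Finset V} {q : ℕ} {x : Finset V →₀ ℤ} :
    x ∈ chainsAvoiding C U ρ q ↔ SupportedOn (facesIn C (↑(U \ ρ)) q) x := by
  unfold chainsAvoiding SupportedOn
  rw [Submodule.mem_toAddSubgroup, Finsupp.mem_supported]
  simp [Set.subset_def]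

lemma chainsAvoiding_insert_le (C : Set (Finset V)) (U ρ : Finset V) (v : V) (q : ℕ) :
    chainsAvoiding C U (insert v ρ) q ≤ chainsAvoiding C U ρ q := by
  refine Finsupp.supported_mono (M := ℤ) (R := ℤ) ?_
  rintro s ⟨h1, h2, h3⟩
  refine ⟨h1, h2.trans ?_, h3⟩
  exact_mod_cast Finset.sdiff_subset_sdiff le_rfl (Finset.subset_insert v ρ)

lemma IsLeray.exists_fill {d : ℕ} {C : Set (Finset V)} (hL : IsLeray d C) {U ρ : Finset V} {q : ℕ}
    (hq : d < q) {z : Finset V →₀ ℤ} (hz : z ∈ chainsAvoiding C U ρ q)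
    (hz0 : boundaryMap V z = 0) :
    ∃ y ∈ chainsAvoiding C U ρ (q + 1), boundaryMap V y = z := by
  obtain ⟨j, rfl⟩ : ∃ j, q = j + 1 := ⟨q - 1, by omega⟩
  obtain ⟨y, hy, hyz⟩ := hL (↑(U \ ρ)) j (by omega) z (mem_chainsAvoiding.1 hz) hz0
  exact ⟨y, mem_chainsAvoiding.2 hy, hyz⟩

/-- A trace computation: a full cubical family would be a null-homotopy of a chain map whose only
nonzero diagonal entry is the one at the empty simplex. -/
theorem not_isCubicalFamily {C : Set (Finset V)} (h0 : ∅ ∈ C) (U : Finset V) (hC : IsComplex C)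
    (F : Finset V → Finset V → Finset V →₀ ℤ) :
    ¬ IsCubicalFamily (restrictComplex C U) (boundaryMap V).toAddMonoidHom
      (Finsupp.single ∅ 1) (chainsAvoiding C U) F (U.card + 1) := by
  classical
  intro hF
  obtain ⟨T, hT⟩ : ∃ T : Finset (Finset V), ∀ s, s ∈ T ↔ s ∈ C ∧ s ⊆ U :=
    ⟨U.powerset.filter (· ∈ C), fun s => by simp [and_comm]⟩
  have hmem : ∀ σ ∈ T, F ∅ σ ∈ chainsAvoiding C U ∅ (σ.card + 1) ∧
      boundaryMap V (F ∅ σ) = cubeBoundary (Finsupp.single ∅ 1) F ∅ σ := fun σ hσ =>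
    hF ∅ σ (by simp) (by simpa [restrictComplex] using (hT σ).1 hσ)
      (Nat.lt_succ_of_le (Finset.card_le_card ((hT σ).1 hσ).2))
  have hleft : ∀ σ ∈ T, boundaryMap V (F ∅ σ) σ =
      ∑ v ∈ U \ σ, vertexSign v σ * F ∅ σ (insert v σ) := fun σ hσ =>
    boundaryMap_apply (Finsupp.supported_mono (fun s hs => by simpa using hs.2.1)
      (hmem σ hσ).1) σ
  have hright : ∀ σ ∈ T, boundaryMap V (F ∅ σ) σ =
      (if σ = ∅ then 1 else 0) + ∑ v ∈ σ, vertexSign v σ * F ∅ (σ.erase v) σ := by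
    intro σ hσ
    rw [(hmem σ hσ).2, cubeBoundary, Finsupp.add_apply, Finsupp.finsetSum_apply]
    congr 1
    · split_ifs with h <;> simp [h]
    · refine Finset.sum_congr rfl fun v hv => ?_
      have hσ' := (hT σ).1 hσ
      have hv0 : F (insert v ∅) (σ.erase v) σ = 0 := by
        by_contra hne
        have hsub := (hF (insert v ∅) (σ.erase v) (by simp)
          (by simpa [restrictComplex, Finset.insert_erase hv] using hσ')
          (Nat.lt_succ_of_le (Finset.card_le_card ((Finset.erase_subset _ _).trans hσ'.2)))).1
        have := (mem_chainsAvoiding.1 hsub σ hne).2.1 (Finset.mem_coe.2 hv)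
        simp at this
      rw [Finsupp.smul_apply, Finsupp.sub_apply, hv0, sub_zero, smul_eq_mul]
  have hsum := (Finset.sum_congr rfl fun σ hσ => (hleft σ hσ).symm.trans (hright σ hσ) :
    ∑ σ ∈ T, _ = ∑ σ ∈ T, _)
  rw [Finset.sum_add_distrib, Finset.sum_ite_eq' T ∅, if_pos ((hT ∅).2 ⟨h0, by simp⟩),
    Finset.sum_sigma', Finset.sum_sigma'] at hsum
  have hbij : ∑ x ∈ T.sigma fun σ => U \ σ, vertexSign x.2 x.1 * F ∅ x.1 (insert x.2 x.1) =
      ∑ x ∈ T.sigma fun σ => σ, vertexSign x.2 x.1 * F ∅ (x.1.erase x.2) x.1 := by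
    refine Finset.sum_bij_ne_zero (fun x _ _ => ⟨insert x.2 x.1, x.2⟩) ?_ ?_ ?_ ?_
    · rintro ⟨σ, v⟩ hx hne
      simp only [Finset.mem_sigma, Finset.mem_sdiff] at hx ⊢
      refine ⟨(hT _).2 ?_, Finset.mem_insert_self _ _⟩
      have := mem_chainsAvoiding.1 (hmem σ hx.1).1 _ (right_ne_zero_of_mul hne)
      exact ⟨this.1, by simpa only [Finset.sdiff_empty, Finset.coe_subset] using this.2.1⟩
    · rintro ⟨σ, v⟩ hx - ⟨σ', v'⟩ hx' - h
      simp only [Finset.mem_sigma, Finset.mem_sdiff, Sigma.mk.injEq, heq_eq_eq] at hx hx' h ⊢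
      obtain ⟨h, rfl⟩ := h
      refine ⟨?_, rfl⟩
      rw [← Finset.erase_insert hx.2.2, h, Finset.erase_insert hx'.2.2]
    · rintro ⟨σ, v⟩ hx hne
      simp only [Finset.mem_sigma] at hx
      have hσ := (hT σ).1 hx.1
      refine ⟨⟨σ.erase v, v⟩, ?_, ?_, ?_⟩
      · simp only [Finset.mem_sigma, Finset.mem_sdiff]
        exact ⟨(hT _).2 ⟨hC _ hσ.1 _ (Finset.erase_subset _ _),
          (Finset.erase_subset _ _).trans hσ.2⟩, hσ.2 hx.2, Finset.notMem_erase _ _⟩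
      · simpa only [vertexSign_erase_self, Finset.insert_erase hx.2] using hne
      · simp only [Finset.insert_erase hx.2]
    · rintro ⟨σ, v⟩ hx -
      simp only [Finset.mem_sigma, Finset.mem_sdiff] at hx
      simp only [vertexSign_insert_self, Finset.erase_insert hx.2.2]
  rw [hbij] at hsum
  linarith

end Trace

/-- Kalai–Meshulam for partial transversals: if every partial transversal is a face of the
`d`-Leray complex `C`, then the union of some `k` of the `d + k` sets is a face of `C`. -/
theorem exists_biUnion_mem_of_isRainbow {V : Type*} [LinearOrder V] {d k : ℕ} (hk : 1 ≤ k)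
    {C : Set (Finset V)} (hC : IsComplex C) (hL : IsLeray d C) (S : Fin (d + k) → Finset V)
    (hR : ∀ τ, IsRainbow_s5 S Finset.univ τ → τ ∈ C) :
    ∃ I : Finset (Fin (d + k)), I.card = k ∧ I.biUnion S ∈ C := by
  by_contra! hS
  have : Nonempty (Fin (d + k)) := ⟨⟨0, by omega⟩⟩
  have h0 : ∅ ∈ C := hR ∅ ⟨fun _ => Classical.arbitrary _, by simp, by simp⟩
  obtain ⟨U, hU⟩ : ∃ U, U = Finset.univ.biUnion S := ⟨_, rfl⟩
  have hX := restrictComplex.isComplex hC U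
  obtain ⟨N, _, ⟨K⟩⟩ := JoinComplex.exists_type S Finset.univ
  have hmany : ∀ ρ ∈ restrictComplex C U,
      d < (Finset.univ.filter fun i => ¬ S i ⊆ ρ).card := by
    intro ρ hρ
    by_contra! hle
    have hadd := Finset.card_filter_add_card_filter_not (s := Finset.univ) (fun i => S i ⊆ ρ)
    rw [Finset.card_univ, Fintype.card_fin] at hadd
    obtain ⟨I, hI, hIk⟩ := Finset.exists_subset_card_eq
      (show k ≤ (Finset.univ.filter fun i => S i ⊆ ρ).card by omega)
    exact hS I hIk (hC _ hρ.1 _ (Finset.biUnion_subset.2 fun i hi =>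
      (Finset.mem_filter.1 (hI hi)).2))
  have hstart : IsCubicalFamily (restrictComplex C U) K.D K.o K.A 0 0 :=
    fun ρ π _ _ h => absurd h (Nat.not_lt_zero _)
  obtain ⟨F, hF⟩ := hstart.exists_of_le hX K.D_o K.A_anti K.o_mem (Nat.zero_le (d + 1))
    fun q _ hq ρ hρ => K.fill ρ q (by have := hmany ρ hρ; omega)
  have hF' := hF.map (D' := (boundaryMap V).toAddMonoidHom) (A' := chainsAvoiding C U) K.p K.p_D
    (fun ρ _ q x hx => Finsupp.supported_mono (by
      rintro τ ⟨h1, h2, h3⟩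
      refine ⟨hR τ h1, fun x hx => ?_, h3⟩
      obtain ⟨f, -, hf⟩ := h1
      simp only [Finset.coe_sdiff, Set.mem_sdiff, Finset.mem_coe]
      exact ⟨hU ▸ Finset.mem_biUnion.2 ⟨f x, Finset.mem_univ _, (hf x hx).2⟩,
        Finset.disjoint_left.1 h2 hx⟩) (K.p_mem ρ q x hx)) hX
  rw [K.p_o] at hF'
  obtain ⟨G, hG⟩ := hF'.exists_of_le hX (by simp [boundaryMap_single])
    (chainsAvoiding_insert_le C U)
    (fun ρ => Finsupp.single_mem_supported ℤ _ ⟨h0, by simp, rfl⟩)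
    (Nat.le_add_left (d + 1) (U.card + 1))
    fun q hq _ ρ _ z hz hz0 => hL.exists_fill (by omega) hz hz0
  exact not_isCubicalFamily h0 U hC G fun ρ π h1 h2 h3 => hG ρ π h1 h2 (by omega)

/-- Cooperative Kalai–Meshulam theorem: if `C` is `d`-Leray and
`S_1, …, S_{d+k}` are vertex sets such that the union of every `k` of them is
not a face of `C`, then some rainbow set is not a face of `C`. -/
theorem stmt_5 {V : Type*} [LinearOrder V] (d k : ℕ) (hk : 1 ≤ k)
    (C : Set (Finset V)) (hC : IsComplex C) (hL : IsLeray d C)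
    (S : Fin (d + k) → Finset V)
    (hS : ∀ I : Finset (Fin (d + k)), I.card = k → I.biUnion S ∉ C) :
    ∃ (m : ℕ) (g : Fin m ↪ Fin (d + k)) (x : Fin m → V),
      Function.Injective x ∧ (∀ j, x j ∈ S (g j)) ∧
        (Finset.univ.image x) ∉ C := by
  by_contra! hcon
  obtain ⟨I, hI, hIC⟩ := exists_biUnion_mem_of_isRainbow hk hC hL S fun τ ⟨f, hf, hfS⟩ => by
    have := hcon τ.card
      ⟨fun j => f (τ.equivFin.symm j), fun i j hij => τ.equivFin.symm.injective
        (Subtype.ext (hf (τ.equivFin.symm i).2 (τ.equivFin.symm j).2 hij))⟩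
      (fun j => τ.equivFin.symm j) (Subtype.val_injective.comp τ.equivFin.symm.injective)
      fun j => (hfS _ (τ.equivFin.symm j).2).2
    convert this
    ext v
    simp only [Finset.mem_image, Finset.mem_univ, true_and]
    exact ⟨fun hv => ⟨τ.equivFin ⟨v, hv⟩, by simp⟩, fun ⟨j, hj⟩ => hj ▸ (τ.equivFin.symm j).2⟩
  exact hS I hI hIC
end

section
/- If S_1, ..., S_{d+1} are nonempty subsets of ℝ^d and v ∈ conv(S_i ∪ S_j) for all 1 ≤ i < j ≤ d+1, then there exists a rainbow set S (one point from each of some distinct S_i's) with v ∈ conv(S). -/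
/-- Moving from a nonnegative vector in a direction with a negative coordinate, one eventually
hits a coordinate hyperplane for the first time. -/
lemma exists_add_smul_nonneg_eq_zero {κ : Type*} [Finite κ] (a b : κ → ℝ) (ha : 0 ≤ a)
    (hb : ∃ k, b k < 0) :
    ∃ τ : ℝ, 0 ≤ τ ∧ 0 ≤ a + τ • b ∧ ∃ k, b k < 0 ∧ (a + τ • b) k = 0 := by
  classical
  have := Fintype.ofFinite κ
  obtain ⟨k₀, hk₀⟩ := hb
  obtain ⟨k, hk, hmin⟩ := Finset.exists_min_image (Finset.univ.filter fun k => b k < 0)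
    (fun k => a k / -b k) ⟨k₀, by simpa using hk₀⟩
  have hbk : b k < 0 := by simpa using hk
  have hτ : 0 ≤ a k / -b k := div_nonneg (ha k) (by linarith)
  refine ⟨a k / -b k, hτ, fun l => ?_, k, hbk, ?_⟩
  · simp only [Pi.zero_apply, Pi.add_apply, Pi.smul_apply, smul_eq_mul]
    have hal := ha l
    simp only [Pi.zero_apply] at hal
    rcases lt_or_ge (b l) 0 with hl | hl
    · have h := hmin l (by simpa using hl)
      rw [le_div_iff₀ (by linarith)] at h
      linarith
    · have := mul_nonneg hτ hl
      linarith
  · simp only [Pi.add_apply, Pi.smul_apply, smul_eq_mul]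
    have := hbk.ne
    field_simp
    ring

lemma exists_neg_of_sum_eq_zero {κ : Type*} [Fintype κ] {b : κ → ℝ} (hb : b ≠ 0)
    (hsum : ∑ k, b k = 0) : ∃ k, b k < 0 := by
  by_contra! h
  exact hb (funext fun k => (Finset.sum_eq_zero_iff_of_nonneg fun k _ => h k).1 hsum k (by simp))

/-- If the nonzero nonnegative relations of a family of vectors vanish at one index at most and
the family exceeds the dimension by at least two, then the number of indices at which some such
relation vanishes is even. -/
lemma even_card_vanishing_index {κ E : Type*} [Fintype κ] [AddCommGroup E] [Module ℝ E]
    [FiniteDimensional ℝ E] (hcard : Module.finrank ℝ E + 2 ≤ Fintype.card κ) (v : κ → E)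
    (hv : ∀ a : κ → ℝ, 0 ≤ a → a ≠ 0 → ∑ k, a k • v k = 0 → ∀ k l, a k = 0 → a l = 0 → k = l) :
    Even (Nat.card {k // ∃ a : κ → ℝ, 0 ≤ a ∧ a ≠ 0 ∧ ∑ k, a k • v k = 0 ∧ a k = 0}) := by
  classical
  let P : κ → Prop := fun k => ∃ a : κ → ℝ, 0 ≤ a ∧ a ≠ 0 ∧ ∑ k, a k • v k = 0 ∧ a k = 0
  change Even (Nat.card {k // P k})
  have hlin : ∀ (a b : κ → ℝ) (τ : ℝ), ∑ k, a k • v k = 0 → ∑ k, b k • v k = 0 →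
      ∑ k, (a + τ • b) k • v k = 0 := by
    intro a b τ ha hb
    simp only [Pi.add_apply, Pi.smul_apply, add_smul, smul_assoc, Finset.sum_add_distrib,
      ← Finset.smul_sum, ha, hb, smul_zero, add_zero]
  by_cases hne : ∃ k, P k
  swap
  · have : IsEmpty {k // P k} := ⟨fun k => hne ⟨k, k.2⟩⟩
    simp
  obtain ⟨-, a, ha, ha0, hav, -⟩ := hne
  have hpos : 0 < ∑ k, a k := by
    refine lt_of_le_of_ne (Finset.sum_nonneg fun k _ => ha k) fun h => ha0 (funext fun k => ?_)
    exact (Finset.sum_eq_zero_iff_of_nonneg fun k _ => ha k).1 h.symm k (by simp)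
  obtain ⟨b, hb0, hbv, hbs⟩ : ∃ b : κ → ℝ, b ≠ 0 ∧ ∑ k, b k • v k = 0 ∧ ∑ k, b k = 0 := by
    let L : (κ → ℝ) →ₗ[ℝ] E × ℝ := Fintype.linearCombination ℝ fun k => (v k, (1 : ℝ))
    have hL : LinearMap.ker L ≠ ⊥ := LinearMap.ker_ne_bot_of_finrank_lt (by simp; omega)
    obtain ⟨b, hb, hb0⟩ := Submodule.exists_mem_ne_zero_of_ne_bot hL
    rw [LinearMap.mem_ker, Fintype.linearCombination_apply] at hb
    refine ⟨b, hb0, ?_, ?_⟩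
    · simpa [Prod.fst_sum] using congrArg Prod.fst hb
    · simpa [Prod.snd_sum] using congrArg Prod.snd hb
  have hvanish : ∀ b : κ → ℝ, b ≠ 0 → ∑ k, b k • v k = 0 → ∑ k, b k = 0 →
      ∃ k, b k < 0 ∧ P k := by
    intro b hb0 hbv hbs
    obtain ⟨τ, -, hnn, k, hk, hzero⟩ :=
      exists_add_smul_nonneg_eq_zero a b ha (exists_neg_of_sum_eq_zero hb0 hbs)
    refine ⟨k, hk, a + τ • b, hnn, fun h => ?_, hlin a b τ hav hbv, hzero⟩
    have : ∑ k, (a + τ • b) k = 0 := by simp only [h, Pi.zero_apply, Finset.sum_const_zero]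
    simp only [Pi.add_apply, Pi.smul_apply, smul_eq_mul, Finset.sum_add_distrib,
      ← Finset.mul_sum, hbs] at this
    linarith
  obtain ⟨k₁, hk₁, hPk₁⟩ := hvanish b hb0 hbv hbs
  obtain ⟨k₂, hk₂, hPk₂⟩ := hvanish (-b) (neg_ne_zero.2 hb0) (by simp [hbv]) (by simp [hbs])
  have h12 : k₁ ≠ k₂ := by
    rintro rfl
    simp only [Pi.neg_apply] at hk₂
    linarith
  have hthird : ∀ k, P k → k = k₁ ∨ k = k₂ := by
    rintro k₃ ⟨e, he, he0, hev, he3⟩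
    by_contra! h3
    obtain ⟨f, hf, hf0, hfv, hf1⟩ := hPk₁
    obtain ⟨g, hg, hg0, hgv, hg2⟩ := hPk₂
    have pos : ∀ {a : κ → ℝ} {k l}, 0 ≤ a → a ≠ 0 → ∑ k, a k • v k = 0 → a k = 0 → l ≠ k →
        0 < a l := fun ha h0 h hk hl =>
      lt_of_le_of_ne (ha _) fun h' => hl (hv _ ha h0 h _ _ h'.symm hk)
    have hg1 := pos hg hg0 hgv hg2 h12
    have he1 := pos he he0 hev he3 h3.1.symm
    have he2 := pos he he0 hev he3 h3.2.symm
    have hg3 := pos hg hg0 hgv hg2 h3.2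
    have hf3 := pos hf hf0 hfv hf1 h3.1
    set c : κ → ℝ := e k₁ • g + (-g k₁) • e with hc
    have hc1 : c k₁ = 0 := by simp [hc]; ring
    have hc2 : c k₂ < 0 := by simpa [hc, hg2] using mul_pos hg1 he2
    have hc3 : 0 < c k₃ := by simpa [hc, he3] using mul_pos he1 hg3
    have hcv : ∑ k, c k • v k = 0 := by
      refine hlin _ _ _ ?_ hev
      simp only [Pi.smul_apply, smul_assoc, ← Finset.smul_sum, hgv, smul_zero]
    obtain ⟨τ, hτ, hnn, k, hk, hzero⟩ := exists_add_smul_nonneg_eq_zero f c hf ⟨k₂, hc2⟩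
    have hne : f + τ • c ≠ 0 := fun h => by
      have := congrFun h k₃
      simp only [Pi.add_apply, Pi.smul_apply, smul_eq_mul, Pi.zero_apply] at this
      nlinarith [mul_nonneg hτ hc3.le]
    have := hv _ hnn hne (hlin f c τ hfv hcv) k k₁ hzero (by simp [hf1, hc1])
    subst this
    linarith
  have : ∀ k, P k ↔ k ∈ ({k₁, k₂} : Finset κ) := by
    intro k
    simp only [Finset.mem_insert, Finset.mem_singleton]
    refine ⟨hthird k, ?_⟩
    rintro (rfl | rfl) <;> assumption
  simp only [this, Nat.card_eq_fintype_card, Fintype.card_coe, Finset.card_pair h12, even_two]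

/-- Parity on the boundary of a cross-polytope: if no cone over a facet contains `q₁`, then
the number of cones over facets that contain `q₀` is even, for `q₀`, `q₁` in general position. -/
lemma even_card_facet_cones {ι E : Type*} [Fintype ι] [AddCommGroup E] [Module ℝ E]
    [FiniteDimensional ℝ E] (hcard : Module.finrank ℝ E = Fintype.card ι) (x : ι → Bool → E)
    (q₀ q₁ : E)
    (hpointed : ∀ (σ : ι → Bool) (a : ι → ℝ), 0 ≤ a → ∑ i, a i • x i (σ i) = 0 → a = 0)
    (hq₀ : ∀ (σ : ι → Bool) (a : ι → ℝ), 0 ≤ a → ∑ i, a i • x i (σ i) = q₀ → ∀ i, a i ≠ 0)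
    (hq₁ : ∀ (σ : ι → Bool) (a : ι → ℝ), 0 ≤ a → ∑ i, a i • x i (σ i) ≠ q₁)
    (hgen : ∀ (σ : ι → Bool) (a : ι → ℝ) (s : ℝ) (i j : ι), i ≠ j → a i = 0 → a j = 0 →
      s • q₀ + ∑ i, a i • x i (σ i) ≠ q₁) :
    Even (Nat.card {σ : ι → Bool // ∃ a : ι → ℝ, 0 ≤ a ∧ ∑ i, a i • x i (σ i) = q₀}) := by
  classical
  let v : (ι → Bool) → Option (Option ι) → E := fun σ k =>
    k.elim (-q₀) fun k => k.elim (-q₁) fun i => x i (σ i)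
  let P : (ι → Bool) → Option (Option ι) → Prop := fun σ k =>
    ∃ a : Option (Option ι) → ℝ, 0 ≤ a ∧ a ≠ 0 ∧ ∑ k, a k • v σ k = 0 ∧ a k = 0
  have hsum : ∀ σ (a : Option (Option ι) → ℝ), ∑ k, a k • v σ k = 0 ↔
      ∑ i, a (some (some i)) • x i (σ i) = a none • q₀ + a (some none) • q₁ := by
    intro σ a
    simp only [Fintype.sum_option, v, Option.elim, smul_neg]
    rw [← sub_eq_zero (b := _ + _)]
    apply iff_of_eq
    congr 1
    abel
  have hscale : ∀ (σ : ι → Bool) (a : ι → ℝ) (s : ℝ) (q : E), s ≠ 0 →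
      ∑ i, a i • x i (σ i) = s • q → ∑ i, (s⁻¹ • a) i • x i (σ i) = q := by
    intro σ a s q hs h
    simp only [Pi.smul_apply, smul_assoc, ← Finset.smul_sum, h, inv_smul_smul₀ hs]
  have hcoords : ∀ σ (a : Option (Option ι) → ℝ), 0 ≤ a → a ≠ 0 → ∑ k, a k • v σ k = 0 →
      a none = 0 → a (some none) = 0 → False := by
    intro σ a ha h0 h h1 h2
    rw [hsum, h1, h2, zero_smul, zero_smul, add_zero] at h
    have := hpointed σ (fun i => a (some (some i))) (fun i => ha _) h
    refine h0 (funext fun k => ?_)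
    rcases k with _ | _ | i
    exacts [h1, h2, congrFun this i]
  have hnone : ∀ σ, ¬ P σ none := by
    rintro σ ⟨a, ha, h0, h, h1⟩
    have h2 : a (some none) ≠ 0 := hcoords σ a ha h0 h h1
    rw [hsum, h1, zero_smul, zero_add] at h
    exact hq₁ σ _ (smul_nonneg (inv_nonneg.2 (ha _)) fun i => ha _)
      (hscale σ (fun i => a (some (some i))) _ _ h2 h)
  have hsn : ∀ σ, P σ (some none) ↔ ∃ a : ι → ℝ, 0 ≤ a ∧ ∑ i, a i • x i (σ i) = q₀ := by
    intro σ
    constructor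
    · rintro ⟨a, ha, h0, h, h1⟩
      have h2 : a none ≠ 0 := fun h2 => hcoords σ a ha h0 h h2 h1
      rw [hsum, h1, zero_smul, add_zero] at h
      exact ⟨_, smul_nonneg (inv_nonneg.2 (ha _)) fun i => ha _,
        hscale σ (fun i => a (some (some i))) _ _ h2 h⟩
    · rintro ⟨a, ha, h⟩
      refine ⟨fun k => k.elim 1 fun k => k.elim 0 a, ?_, fun h => ?_, ?_, rfl⟩
      · rintro (_ | _ | i)
        exacts [zero_le_one, le_rfl, ha i]
      · exact one_ne_zero (congrFun h none)
      · rw [hsum]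
        simpa using h
  have hcolor : ∀ σ i, P (Function.update σ i !σ i) (some (some i)) ↔ P σ (some (some i)) := by
    intro σ i
    refine exists_congr fun a => and_congr_right fun _ => and_congr_right fun _ =>
      and_congr_left fun h => ?_
    rw [hsum, hsum]
    apply iff_of_eq
    congr 1
    refine Finset.sum_congr rfl fun j _ => ?_
    rcases eq_or_ne j i with rfl | hj
    · simp [h]
    · simp [hj]
  have heven : ∀ σ, Even (Nat.card {k // P σ k}) := by
    intro σ
    refine even_card_vanishing_index (by simp [hcard]) (v σ) ?_
    have key : ∀ a : Option (Option ι) → ℝ, 0 ≤ a → a ≠ 0 → ∑ k, a k • v σ k = 0 →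
        a none ≠ 0 ∧ (∀ i, a (some none) = 0 → a (some (some i)) ≠ 0) ∧
        ∀ i j, a (some (some i)) = 0 → a (some (some j)) = 0 → i = j := by
      intro a ha h0 h
      have h1 : a none ≠ 0 := fun h1 => hnone σ ⟨a, ha, h0, h, h1⟩
      have h2 : ∀ i, a (some none) = 0 → a (some (some i)) ≠ 0 := by
        intro i h2 h3
        have h' := h
        rw [hsum, h2, zero_smul, add_zero] at h'
        exact hq₀ σ _ (smul_nonneg (inv_nonneg.2 (ha _)) fun i => ha _)
          (hscale σ (fun i => a (some (some i))) _ _ h1 h') i (by simp [h3])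
      refine ⟨h1, h2, fun i j hi hj => ?_⟩
      by_contra hij
      have h3 : a (some none) ≠ 0 := fun h3 => h2 i h3 hi
      rw [hsum] at h
      refine hgen σ ((a (some none))⁻¹ • fun i => a (some (some i)))
        (-((a (some none))⁻¹ * a none)) i j hij (by simp [hi]) (by simp [hj]) ?_
      simp only [Pi.smul_apply, smul_assoc, ← Finset.smul_sum, h, smul_add, inv_smul_smul₀ h3]
      simp [mul_smul]
    intro a ha h0 h k l hk hl
    obtain ⟨h1, h2, h3⟩ := key a ha h0 h
    rcases k with _ | _ | i <;> rcases l with _ | _ | j <;> first | rfl | skip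
    · exact absurd hk h1
    · exact absurd hk h1
    · exact absurd hl h1
    · exact absurd hl (h2 j hk)
    · exact absurd hl h1
    · exact absurd hk (h2 i hl)
    · rw [h3 i j hk hl]
  have hrow : ∀ σ, ∑ k, (if P σ k then 1 else 0 : ZMod 2) = 0 := by
    intro σ
    have := heven σ
    rw [Nat.card_eq_fintype_card, Fintype.card_subtype] at this
    rw [Finset.sum_boole]
    exact (ZMod.natCast_eq_zero_iff_even).2 this
  have htotal : ∑ k, ∑ σ, (if P σ k then 1 else 0 : ZMod 2) = 0 := by
    rw [Finset.sum_comm]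
    exact Finset.sum_eq_zero fun σ _ => hrow σ
  have hcol : ∀ i, ∑ σ, (if P σ (some (some i)) then 1 else 0 : ZMod 2) = 0 := by
    intro i
    refine Finset.sum_involution (fun σ _ => Function.update σ i !σ i) ?_ ?_ ?_ ?_
    · intro σ _
      simp only [hcolor]
      exact CharTwo.add_self_eq_zero _
    · intro σ _ _ h
      simpa using congrFun h i
    · simp
    · simp
  simp only [Fintype.sum_option, hnone, hcol, if_false, Finset.sum_const_zero, zero_add,
    add_zero, hsn] at htotal
  rw [Finset.sum_boole] at htotal
  rw [Nat.card_eq_fintype_card, Fintype.card_subtype]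
  exact (ZMod.natCast_eq_zero_iff_even).1 htotal

/-- A nonempty open set is not covered by finitely many proper subspaces. -/
lemma IsOpen.exists_forall_notMem_submodule {E α : Type*} [Finite α] [NormedAddCommGroup E]
    [NormedSpace ℝ E] [FiniteDimensional ℝ E] {U : Set E} (hU : IsOpen U) (hne : U.Nonempty)
    (V : α → Submodule ℝ E) (hV : ∀ i, V i ≠ ⊤) : ∃ q ∈ U, ∀ i, q ∉ V i := by
  borelize E
  by_contra! h
  let μ : MeasureTheory.Measure E := MeasureTheory.Measure.addHaar
  have h0 : μ (⋃ i, (V i : Set E)) = 0 :=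
    MeasureTheory.measure_iUnion_null fun i => MeasureTheory.Measure.addHaar_submodule _ _ (hV i)
  exact (hU.measure_pos μ hne).ne' (MeasureTheory.measure_mono_null
    (fun q hq => Set.mem_iUnion.2 (h q hq)) h0)

/-- A nonempty open set contains a point avoiding the spans of `q₀` together with all but two
vectors of each of finitely many families of `finrank ℝ E` vectors. -/
lemma IsOpen.exists_generic {ι α E : Type*} [Fintype ι] [Finite α] [NormedAddCommGroup E]
    [NormedSpace ℝ E] [FiniteDimensional ℝ E] (hcard : Module.finrank ℝ E = Fintype.card ι)
    {U : Set E} (hU : IsOpen U) (hne : U.Nonempty) (w : α → ι → E) (q₀ : E) :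
    ∃ q ∈ U, ∀ (σ : α) (a : ι → ℝ) (s : ℝ) (i j : ι), i ≠ j → a i = 0 → a j = 0 →
      s • q₀ + ∑ i, a i • w σ i ≠ q := by
  classical
  let V : α × ι × ι → Submodule ℝ E := fun t =>
    Submodule.span ℝ (Set.range fun k : {k // k ≠ t.2.2} => Function.update (w t.1) t.2.1 q₀ k)
  obtain ⟨q, hqU, hq⟩ := hU.exists_forall_notMem_submodule hne V fun t htop => by
    have h1 : Module.finrank ℝ (V t) ≤ Fintype.card {k // k ≠ t.2.2} := finrank_range_le_card _
    have h2 : Fintype.card {k // k ≠ t.2.2} < Fintype.card ι :=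
      Fintype.card_subtype_lt (x := t.2.2) (by simp)
    rw [htop, finrank_top] at h1
    omega
  refine ⟨q, hqU, fun σ a s i j hij hi hj h => hq (σ, i, j) ?_⟩
  have hmem : ∀ k, k ≠ j → Function.update (w σ) i q₀ k ∈ V (σ, i, j) := fun k hk =>
    Submodule.subset_span ⟨⟨k, hk⟩, rfl⟩
  rw [← h]
  refine add_mem (Submodule.smul_mem _ _ ?_) (Submodule.sum_mem _ fun k _ => ?_)
  · simpa using hmem i hij
  · rcases eq_or_ne k i with rfl | hki
    · simp [hi]
    rcases eq_or_ne k j with rfl | hkj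
    · simp [hj]
    · simpa [hki] using Submodule.smul_mem _ (a k) (hmem k hkj)

lemma inner_self_le_inner_of_norm_le {E : Type*} [NormedAddCommGroup E] [InnerProductSpace ℝ E]
    {p y : E} (h : ∀ τ : ℝ, 0 ≤ τ → τ ≤ 1 → ‖p‖ ≤ ‖p + τ • (y - p)‖) :
    inner ℝ p p ≤ inner ℝ p y := by
  by_contra! hlt
  set D : ℝ := inner ℝ p p - inner ℝ p y with hD
  set N : ℝ := ‖y - p‖ ^ 2 with hN
  have hD0 : 0 < D := by linarith
  have hN0 : 0 ≤ N := sq_nonneg _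
  have hτ0 : 0 < D / (D + N) := by positivity
  have hτ1 : D / (D + N) ≤ 1 := by rw [div_le_one (by positivity)]; linarith
  set τ : ℝ := D / (D + N) with hτ
  have hτN : τ * (D + N) = D := by rw [hτ]; field_simp
  have hsq := pow_le_pow_left₀ (norm_nonneg p) (h τ hτ0.le hτ1) 2
  rw [norm_add_sq_real, norm_smul, inner_smul_right, inner_sub_right, mul_pow, ← hN,
    Real.norm_eq_abs, sq_abs] at hsq
  have h1 : inner ℝ p y - inner ℝ p p = -D := by rw [hD]; ring
  rw [h1] at hsq
  have h2 : 0 ≤ τ * (τ * N - 2 * D) := by nlinarith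
  have h3 := nonneg_of_mul_nonneg_right h2 hτ0
  nlinarith

/-- The strong colorful Carathéodory theorem for finite color classes, in an inner product
space. -/
theorem exists_rainbow_zero_mem_convexHull {d : ℕ} {E : Type*} [NormedAddCommGroup E]
    [InnerProductSpace ℝ E] [FiniteDimensional ℝ E] (hd : Module.finrank ℝ E = d)
    (T : Fin (d + 1) → Set E) (hfin : ∀ i, (T i).Finite) (hne : ∀ i, (T i).Nonempty)
    (hpair : ∀ i j, i ≠ j → (0 : E) ∈ convexHull ℝ (T i ∪ T j)) :
    ∃ c : Fin (d + 1) → E, (∀ i, c i ∈ T i) ∧ (0 : E) ∈ convexHull ℝ (Set.range c) := by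
  classical
  by_contra! hno
  have hno' : ∀ c : Fin (d + 1) → E, (∀ i, c i ∈ T i) → ∀ μ ∈ stdSimplex ℝ (Fin (d + 1)),
      ∑ i, μ i • c i ≠ 0 := fun c hc μ hμ h =>
    hno c hc (mem_convexHull_of_exists_fintype μ c hμ.1 hμ.2 (fun i => Set.mem_range_self i) h)
  obtain ⟨⟨c, μ₀⟩, ⟨hc, hμ₀⟩, hmin⟩ := IsCompact.exists_isMinOn
    ((isCompact_univ_pi fun i => (hfin i).isCompact).prod (isCompact_stdSimplex ℝ (Fin (d + 1))))
    ((Set.univ_pi_nonempty_iff.2 hne).prod ⟨_, single_mem_stdSimplex ℝ (0 : Fin (d + 1))⟩)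
    (f := fun t : (Fin (d + 1) → E) × (Fin (d + 1) → ℝ) => ‖∑ i, t.2 i • t.1 i‖)
    (by fun_prop)
  replace hc : ∀ i, c i ∈ T i := fun i => hc i trivial
  set p : E := ∑ i, μ₀ i • c i with hp
  have hp0 : p ≠ 0 := hno' c hc μ₀ hμ₀
  have hpp : 0 < inner ℝ p p := real_inner_self_pos.2 hp0
  replace hmin : ∀ c' : Fin (d + 1) → E, (∀ i, c' i ∈ T i) → ∀ μ ∈ stdSimplex ℝ (Fin (d + 1)),
      ‖p‖ ≤ ‖∑ i, μ i • c' i‖ := fun c' hc' μ hμ => hmin (a := (c', μ)) ⟨fun i _ => hc' i, hμ⟩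
  have hhalf : ∀ c' : Fin (d + 1) → E, (∀ i, c' i ∈ T i) → ∀ μ ∈ stdSimplex ℝ (Fin (d + 1)),
      ∑ i, μ i • c' i = p → ∀ k, inner ℝ p p ≤ inner ℝ p (c' k) := by
    intro c' hc' μ hμ h k
    refine inner_self_le_inner_of_norm_le fun τ h0 h1 => ?_
    have := hmin c' hc' _ (convex_stdSimplex ℝ (Fin (d + 1)) hμ (single_mem_stdSimplex ℝ k)
      (sub_nonneg.2 h1) h0 (sub_add_cancel _ _))
    convert this using 2
    simp only [Pi.add_apply, Pi.smul_apply, add_smul, smul_assoc, Finset.sum_add_distrib,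
      ← Finset.smul_sum, h, Pi.single_apply, ite_smul, one_smul, zero_smul,
      Finset.sum_ite_eq', Finset.mem_univ, if_true]
    module
  have hface : ∀ μ ∈ stdSimplex ℝ (Fin (d + 1)), ∑ i, μ i • c i = p →
      ∀ k, 0 < μ k → inner ℝ p (c k) = inner ℝ p p := by
    intro μ hμ h k hk
    have h1 : ∑ i, μ i * (inner ℝ p (c i) - inner ℝ p p) = 0 := by
      have : inner ℝ p (∑ i, μ i • c i) = inner ℝ p p := by rw [h]
      simp only [inner_sum, inner_smul_right] at this
      simp only [mul_sub, Finset.sum_sub_distrib, ← Finset.sum_mul, hμ.2, this, one_mul, sub_self]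
    have h2 := (Finset.sum_eq_zero_iff_of_nonneg fun i _ =>
      mul_nonneg (hμ.1 i) (sub_nonneg.2 (hhalf c hc μ hμ h i))).1 h1 k (Finset.mem_univ k)
    rcases mul_eq_zero.1 h2 with h3 | h3 <;> linarith
  obtain ⟨μ, hμ, hμp, i₀, hi₀⟩ : ∃ μ ∈ stdSimplex ℝ (Fin (d + 1)), ∑ i, μ i • c i = p ∧
      ∃ i₀, μ i₀ = 0 := by
    by_cases hz : ∃ i₀, μ₀ i₀ = 0
    · exact ⟨μ₀, hμ₀, rfl, hz⟩
    push Not at hz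
    have hplane : ∀ k, inner ℝ p (c k) = inner ℝ p p := fun k =>
      hface μ₀ hμ₀ rfl k (lt_of_le_of_ne (hμ₀.1 k) (hz k).symm)
    obtain ⟨b, hb, hb0⟩ := Submodule.exists_mem_ne_zero_of_ne_bot
      (LinearMap.ker_ne_bot_of_finrank_lt (f := Fintype.linearCombination ℝ c) (by simp [hd]))
    rw [LinearMap.mem_ker, Fintype.linearCombination_apply] at hb
    have hbs : ∑ i, b i = 0 := by
      have : inner ℝ p (∑ i, b i • c i) = 0 := by rw [hb, inner_zero_right]
      simp only [inner_sum, inner_smul_right, hplane, ← Finset.sum_mul] at this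
      exact (mul_eq_zero.1 this).resolve_right hpp.ne'
    obtain ⟨τ, -, hnn, k, -, hk⟩ := exists_add_smul_nonneg_eq_zero μ₀ b hμ₀.1
      (exists_neg_of_sum_eq_zero hb0 hbs)
    refine ⟨μ₀ + τ • b, ⟨hnn, ?_⟩, ?_, k, hk⟩
    · simp only [Pi.add_apply, Pi.smul_apply, smul_eq_mul, Finset.sum_add_distrib,
        ← Finset.mul_sum, hbs, hμ₀.2, mul_zero, add_zero]
    · simp only [Pi.add_apply, Pi.smul_apply, add_smul, smul_assoc, Finset.sum_add_distrib,
        ← Finset.smul_sum, hb, smul_zero, add_zero, hp]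
  have hswap : ∀ μ ∈ stdSimplex ℝ (Fin (d + 1)), ∑ i, μ i • c i = p → ∀ k, μ k = 0 →
      ∀ y ∈ T k, inner ℝ p p ≤ inner ℝ p y := by
    intro μ hμ h k hk y hy
    have := hhalf (Function.update c k y) (fun i => ?_) μ hμ ?_ k
    · simpa using this
    · rcases eq_or_ne i k with rfl | hi
      · simpa using hy
      · simpa [hi] using hc i
    · rw [← h]
      refine Finset.sum_congr rfl fun i _ => ?_
      rcases eq_or_ne i k with rfl | hi
      · simp [hk]
      · simp [hi]
  have hopp : ∀ j, ∃ y ∈ T (i₀.succAbove j), inner ℝ p y ≤ 0 := by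
    intro j
    by_contra! hpos
    have hsub : T i₀ ∪ T (i₀.succAbove j) ⊆ {y | 0 < inner ℝ p y} := by
      rintro y (hy | hy)
      · exact hpp.trans_le (hswap μ hμ hμp i₀ hi₀ y hy)
      · exact hpos y hy
    have hconv : Convex ℝ {y : E | 0 < inner ℝ p y} :=
      convex_halfSpace_gt (innerₛₗ ℝ p).isLinear 0
    have := convexHull_min hsub hconv (hpair _ _ (Fin.succAbove_ne i₀ j).symm)
    simp at this
  choose y hyT hyp using hopp
  have hposi : ∀ μ ∈ stdSimplex ℝ (Fin (d + 1)), ∑ i, μ i • c i = p →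
      ∀ j, 0 < μ (i₀.succAbove j) := by
    intro μ hμ h j
    refine lt_of_le_of_ne (hμ.1 _) fun h0 => ?_
    linarith [hswap μ hμ h _ h0.symm _ (hyT j), hyp j]
  let x : Fin d → Bool → E := fun j b => if b then c (i₀.succAbove j) else y j
  let s : (Fin d → Bool) → Fin (d + 1) → E := fun σ =>
    i₀.insertNth (α := fun _ => E) (c i₀) fun j => x j (σ j)
  have hs : ∀ σ i, s σ i ∈ T i := by
    intro σ i
    rcases Fin.eq_self_or_eq_succAbove i₀ i with rfl | ⟨j, rfl⟩
    · simpa [s] using hc i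
    · by_cases hj : σ j
      · simpa [s, x, hj] using hc (i₀.succAbove j)
      · simpa [s, x, hj] using hyT j
  have hsep : ∀ σ, ∃ f : StrongDual ℝ E, ∀ i, 0 < f (s σ i) := by
    intro σ
    obtain ⟨f, u, h0, hu⟩ := geometric_hahn_banach_point_closed (convex_convexHull ℝ _)
      ((Set.finite_range (s σ)).isClosed_convexHull ℝ) (hno (s σ) (hs σ))
    rw [map_zero] at h0
    exact ⟨f, fun i => h0.trans (hu _ (subset_convexHull ℝ _ (Set.mem_range_self i)))⟩
  choose f hf using hsep
  have hfx : ∀ σ j, 0 < f σ (x j (σ j)) := fun σ j => by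
    simpa [s] using hf σ (i₀.succAbove j)
  have hunique : ∀ (σ : Fin d → Bool) (a : Fin d → ℝ), 0 ≤ a → ∑ j, a j • x j (σ j) = p →
      σ = (fun _ => true) ∧ ∀ j, a j ≠ 0 := by
    intro σ a ha h
    have hxle : ∀ j, inner ℝ p (x j (σ j)) ≤ inner ℝ p p := by
      intro j
      by_cases hj : σ j
      · simpa [x, hj] using (hface μ hμ hμp _ (hposi μ hμ hμp j)).le
      · simpa [x, hj] using (hyp j).trans hpp.le
    have hge : 1 ≤ ∑ j, a j := by
      have h1 : inner ℝ p (∑ j, a j • x j (σ j)) = inner ℝ p p := by rw [h]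
      simp only [inner_sum, inner_smul_right] at h1
      have h2 : ∑ j, a j * inner ℝ p (x j (σ j)) ≤ ∑ j, a j * inner ℝ p p :=
        Finset.sum_le_sum fun j _ => mul_le_mul_of_nonneg_left (hxle j) (ha j)
      rw [h1, ← Finset.sum_mul] at h2
      exact le_of_mul_le_mul_right (by simpa using h2) hpp
    have hpos : 0 < ∑ j, a j := by linarith
    have hext : ∀ a : Fin d → ℝ, 0 ≤ a → ∑ j, a j = 1 →
        i₀.insertNth (α := fun _ => ℝ) 0 a ∈ stdSimplex ℝ (Fin (d + 1)) := by
      intro a ha h1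
      refine ⟨fun i => ?_, by simp [Fin.sum_univ_succAbove _ i₀, h1]⟩
      rcases Fin.eq_self_or_eq_succAbove i₀ i with rfl | ⟨j, rfl⟩
      · simp
      · simpa using ha j
    have hsums : ∀ a : Fin d → ℝ, ∑ i, i₀.insertNth (α := fun _ => ℝ) 0 a i • s σ i =
        ∑ j, a j • x j (σ j) := by
      intro a
      simp [Fin.sum_univ_succAbove _ i₀, s]
    have hle : ∑ j, a j ≤ 1 := by
      have := hmin (s σ) (hs σ) _ (hext ((∑ j, a j)⁻¹ • a)
        (smul_nonneg (inv_nonneg.2 hpos.le) ha) (by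
          simp only [Pi.smul_apply, smul_eq_mul, ← Finset.mul_sum]
          exact inv_mul_cancel₀ hpos.ne'))
      rw [hsums] at this
      simp only [Pi.smul_apply, smul_assoc, ← Finset.smul_sum, h] at this
      rw [norm_smul, norm_inv, Real.norm_of_nonneg hpos.le, ← div_eq_inv_mul,
        le_div_iff₀ hpos] at this
      exact le_of_mul_le_mul_left (by simpa using this) (norm_pos_iff.2 hp0)
    have hmem := hext a ha (le_antisymm hle hge)
    have hσ : σ = fun _ => true := by
      funext j
      by_contra hj
      have := hhalf (s σ) (hs σ) _ hmem ((hsums a).trans h) (i₀.succAbove j)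
      have hy := hyp j
      have hsy : s σ (i₀.succAbove j) = y j := by simp [s, x, hj]
      rw [hsy] at this
      linarith
    refine ⟨hσ, fun j => ?_⟩
    have hsc : s σ = c := by
      funext i
      rcases Fin.eq_self_or_eq_succAbove i₀ i with rfl | ⟨j, rfl⟩ <;> simp [s, x, hσ]
    have := hposi _ hmem (by rw [← h, ← hsums, hsc]) j
    rw [Fin.insertNth_apply_succAbove] at this
    exact this.ne'
  obtain ⟨q, hq, hgen⟩ := IsOpen.exists_generic (ι := Fin d) (by simp [hd])
    (U := ⋂ σ, {q | f σ q < 0})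
    (isOpen_iInter_of_finite fun σ => isOpen_lt (f σ).continuous continuous_const)
    ⟨-c i₀, Set.mem_iInter.2 fun σ => by simpa [s] using hf σ i₀⟩
    (fun (σ : Fin d → Bool) j => x j (σ j)) p
  rw [Set.mem_iInter] at hq
  have heven := even_card_facet_cones (by simp [hd]) x p q ?_
    (fun σ a ha h => (hunique σ a ha h).2) ?_ hgen
  · have hiff : ∀ σ : Fin d → Bool, (∃ a : Fin d → ℝ, 0 ≤ a ∧ ∑ j, a j • x j (σ j) = p) ↔
        σ = fun _ => true := by
      refine fun σ => ⟨fun ⟨a, ha, h⟩ => (hunique σ a ha h).1, ?_⟩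
      rintro rfl
      refine ⟨fun j => μ (i₀.succAbove j), fun j => hμ.1 _, ?_⟩
      rw [Fin.sum_univ_succAbove _ i₀, hi₀, zero_smul, zero_add] at hμp
      simpa [x] using hμp
    simp only [hiff] at heven
    simp at heven
  · intro σ a ha h
    have h1 : ∑ j, a j * f σ (x j (σ j)) = 0 := by
      simpa [map_sum] using congrArg (f σ) h
    funext j
    have h2 := (Finset.sum_eq_zero_iff_of_nonneg fun j _ =>
      mul_nonneg (ha j) (hfx σ j).le).1 h1 j (Finset.mem_univ j)
    exact (mul_eq_zero.1 h2).resolve_right (hfx σ j).ne'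
  · rintro σ a ha rfl
    have h1 := hq σ
    simp only [Set.mem_ofPred_eq, map_sum, map_smul, smul_eq_mul] at h1
    exact h1.not_ge (Finset.sum_nonneg fun j _ => mul_nonneg (ha j) (hfx σ j).le)

/-- A point of the convex hull of pairwise unions lies in the convex hulls of pairwise unions of
suitable nonempty finite subsets. -/
lemma exists_finite_subsets_mem_convexHull_union {ι E : Type*} [Finite ι] [AddCommGroup E]
    [Module ℝ E] {v : E} {S : ι → Set E} (hne : ∀ i, (S i).Nonempty)
    (hpair : ∀ i j, i ≠ j → v ∈ convexHull ℝ (S i ∪ S j)) :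
    ∃ T : ι → Set E, (∀ i, T i ⊆ S i) ∧ (∀ i, (T i).Finite) ∧ (∀ i, (T i).Nonempty) ∧
      ∀ i j, i ≠ j → v ∈ convexHull ℝ (T i ∪ T j) := by
  have hex : ∀ i j, ∃ F : Finset E, i ≠ j → (F : Set E) ⊆ S i ∪ S j ∧
      v ∈ convexHull ℝ (F : Set E) := by
    intro i j
    by_cases hij : i = j
    · exact ⟨∅, fun h => (h hij).elim⟩
    · have h := hpair i j hij
      rw [convexHull_eq_union_convexHull_finite_subsets] at h
      simp only [Set.mem_iUnion] at h
      obtain ⟨F, hF, hv⟩ := h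
      exact ⟨F, fun _ => ⟨hF, hv⟩⟩
  choose F hF using hex
  choose e he using hne
  refine ⟨fun i => insert (e i) (S i ∩ ⋃ t : ι × ι, (F t.1 t.2 : Set E)), fun i => ?_,
    fun i => ?_, fun i => ⟨e i, Set.mem_insert _ _⟩, fun i j hij => ?_⟩
  · exact Set.insert_subset (he i) Set.inter_subset_left
  · exact ((Set.finite_iUnion fun t : ι × ι => (F t.1 t.2).finite_toSet).inter_of_right _).insert _
  · refine convexHull_mono (fun z hz => ?_) (hF i j hij).2
    have hz' : z ∈ ⋃ t : ι × ι, (F t.1 t.2 : Set E) := Set.mem_iUnion.2 ⟨(i, j), hz⟩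
    exact ((hF i j hij).1 hz).imp (fun h => Or.inr ⟨h, hz'⟩) fun h => Or.inr ⟨h, hz'⟩

/-- Holmsen–Pach–Tverberg / Arocha et al.: if `S_1, …, S_{d+1}` are nonempty
sets in `ℝ^d` and `v ∈ conv(S_i ∪ S_j)` for all `i < j`, then `v` lies in the
convex hull of some rainbow set. -/
theorem stmt_9 (d : ℕ) (v : Fin d → ℝ) (S : Fin (d + 1) → Set (Fin d → ℝ))
    (hne : ∀ i, (S i).Nonempty)
    (hpair : ∀ i j : Fin (d + 1), i < j → v ∈ convexHull ℝ (S i ∪ S j)) :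
    ∃ (m : ℕ) (g : Fin m ↪ Fin (d + 1)) (x : Fin m → (Fin d → ℝ)),
      (∀ j, x j ∈ S (g j)) ∧ v ∈ convexHull ℝ (Set.range x) := by
  have hpair' : ∀ i j, i ≠ j → v ∈ convexHull ℝ (S i ∪ S j) := by
    intro i j hij
    rcases hij.lt_or_gt with h | h
    · exact hpair i j h
    · rw [Set.union_comm]
      exact hpair j i h
  obtain ⟨T, hTS, hTfin, hTne, hTpair⟩ := exists_finite_subsets_mem_convexHull_union hne hpair'
  let φ : (Fin d → ℝ) →ᵃ[ℝ] EuclideanSpace ℝ (Fin d) :=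
    (WithLp.linearEquiv 2 ℝ (Fin d → ℝ)).symm.toLinearMap.toAffineMap -
      AffineMap.const ℝ _ (WithLp.toLp 2 v)
  have hφ : ∀ z, φ z = WithLp.toLp 2 z - WithLp.toLp 2 v := fun z => rfl
  have hφv : φ v = 0 := by rw [hφ, sub_self]
  have hinj : Function.Injective φ := fun z z' h => by
    rw [hφ, hφ, sub_left_inj] at h
    exact WithLp.toLp_injective 2 h
  obtain ⟨c, hc, h0⟩ := exists_rainbow_zero_mem_convexHull (d := d) (by simp)
    (fun i => φ '' T i) (fun i => (hTfin i).image _) (fun i => (hTne i).image _)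
    (fun i j hij => by
      rw [← Set.image_union, ← AffineMap.image_convexHull]
      exact ⟨v, hTpair i j hij, hφv⟩)
  choose x hx hxc using hc
  refine ⟨d + 1, Function.Embedding.refl _, x, fun j => hTS j (hx j), ?_⟩
  have hrange : Set.range c = φ '' Set.range x := by
    rw [← Set.range_comp]
    exact congrArg Set.range (funext fun i => (hxc i).symm)
  rw [hrange, ← AffineMap.image_convexHull, ← hφv] at h0
  exact (hinj.mem_set_image).1 h0
end

section
/- Let F_1, ..., F_{2k-1} be matchings in a bipartite graph with |F_i| = min(i, k) for every i. Then there exists a rainbow matching of size k: a matching {e_1,...,e_k} with e_j ∈ F_{i_j} for distinct indices i_1,...,i_k. -/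
set_option linter.unusedSectionVars false

namespace IndepComplex

open Finset

variable {τ : Type*} [Fintype τ] [DecidableEq τ]

/-- The boundary of a mod 2 chain of finite sets. -/
def boundary (c : Finset τ → ZMod 2) : Finset τ → ZMod 2 :=
  fun s => ∑ x ∈ sᶜ, c (insert x s)

/-- The cone with apex `v` over a chain. -/
def cone (v : τ) (c : Finset τ → ZMod 2) : Finset τ → ZMod 2 :=
  fun s => if v ∈ s then c (s.erase v) else 0

/-- The link of `v` in a chain. -/
def link (v : τ) (c : Finset τ → ZMod 2) : Finset τ → ZMod 2 :=
  fun s => if v ∈ s then 0 else c (insert v s)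

/-- The part of a chain supported on the sets avoiding `v`. -/
def avoid (v : τ) (c : Finset τ → ZMod 2) : Finset τ → ZMod 2 :=
  fun s => if v ∈ s then 0 else c s

lemma boundary_add (b c : Finset τ → ZMod 2) :
    boundary (b + c) = boundary b + boundary c := by
  funext s
  simp [boundary, sum_add_distrib]

lemma boundary_sum {κ : Type*} (t : Finset κ) (c : κ → Finset τ → ZMod 2) :
    boundary (∑ x ∈ t, c x) = ∑ x ∈ t, boundary (c x) := by
  funext s
  simp only [boundary, Finset.sum_apply]
  exact sum_comm

lemma chain_add_self (c : Finset τ → ZMod 2) : c + c = 0 :=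
  funext fun _ => CharTwo.add_self_eq_zero _

lemma boundary_boundary (c : Finset τ → ZMod 2) : boundary (boundary c) = 0 := by
  funext s
  simp only [boundary, Pi.zero_apply]
  rw [sum_sigma']
  refine sum_involution (fun p _ => ⟨p.2, p.1⟩) ?_ ?_ ?_ ?_
  · rintro ⟨x, y⟩ _
    rw [insert_comm x y s]
    exact CharTwo.add_self_eq_zero _
  · rintro ⟨x, y⟩ h _ he
    simp at h he
    grind
  · rintro ⟨x, y⟩ h
    simp at h ⊢
    grind
  · rintro ⟨x, y⟩ _
    rfl

lemma boundary_cone (v : τ) (b : Finset τ → ZMod 2) (hb : ∀ s, v ∈ s → b s = 0) :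
    boundary (cone v b) = b + cone v (boundary b) := by
  funext s
  by_cases hv : v ∈ s
  · have hc : (s.erase v)ᶜ = insert v sᶜ := by ext; simp [or_iff_not_imp_left]
    simp only [boundary, cone, Pi.add_apply, hv, hb s hv, if_true, mem_insert, or_true, hc]
    rw [sum_insert (by simpa using hv), insert_erase hv, hb s hv, zero_add, zero_add]
    refine sum_congr rfl fun x hx => ?_
    rw [erase_insert_of_ne]
    rintro rfl
    simp [hv] at hx
  · simp only [boundary, cone, Pi.add_apply, hv, if_false, add_zero]
    rw [sum_eq_single v]
    · simp [hv]
    · intro x _ hx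
      simp [hv, hx.symm]
    · simp [hv]

lemma avoid_add_cone_link (v : τ) (c : Finset τ → ZMod 2) :
    c = avoid v c + cone v (link v c) := by
  funext s
  by_cases hv : v ∈ s <;> simp [avoid, cone, link, hv]

lemma boundary_link (v : τ) (c : Finset τ → ZMod 2) :
    boundary (link v c) = link v (boundary c) := by
  funext s
  by_cases hv : v ∈ s
  · simp [boundary, link, hv]
  · have hc : sᶜ = insert v (insert v s)ᶜ := by ext x; by_cases x = v <;> simp_all
    simp only [boundary, link, hv, if_false]
    rw [hc, sum_insert (by simp)]
    simp only [mem_insert, true_or, if_true, zero_add]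
    refine sum_congr rfl fun x hx => ?_
    rw [insert_comm v x s, if_neg]
    simp at hx
    grind

/-- The chain `c` is a combination of `n`-element `r`-independent subsets of `V`. -/
def SupportedOn (r : τ → τ → Prop) (V : Finset τ) (n : ℕ) (c : Finset τ → ZMod 2) : Prop :=
  ∀ s, c s ≠ 0 → s ⊆ V ∧ s.card = n ∧ ∀ u ∈ s, ∀ v ∈ s, u ≠ v → ¬ r u v

/-- The reduced mod 2 homology of the complex of `r`-independent subsets of `V` vanishes on
sets with fewer than `q` elements. -/
def Acyclic (r : τ → τ → Prop) (V : Finset τ) (q : ℕ) : Prop :=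
  ∀ n < q, ∀ z, SupportedOn r V n z → boundary z = 0 →
    ∃ c, SupportedOn r V (n + 1) c ∧ boundary c = z

variable {r : τ → τ → Prop} {V W : Finset τ} {n q : ℕ} {b c : Finset τ → ZMod 2} {v : τ}

lemma Acyclic.mono {q' : ℕ} (h : Acyclic r V q) (hq : q' ≤ q) : Acyclic r V q' :=
  fun n hn => h n (hn.trans_le hq)

lemma acyclic_zero : Acyclic r V 0 := fun _ hn => absurd hn (Nat.not_lt_zero _)

lemma SupportedOn.add (hb : SupportedOn r V n b) (hc : SupportedOn r V n c) :
    SupportedOn r V n (b + c) := by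
  intro s hs
  by_cases h : b s = 0
  · exact hc s (by simpa [h] using hs)
  · exact hb s h

lemma SupportedOn.sum {κ : Type*} (t : Finset κ) (c : κ → Finset τ → ZMod 2)
    (h : ∀ x ∈ t, SupportedOn r V n (c x)) : SupportedOn r V n (∑ x ∈ t, c x) := by
  intro s hs
  rw [Finset.sum_apply] at hs
  obtain ⟨x, hx, hne⟩ := exists_ne_zero_of_sum_ne_zero hs
  exact h x hx s hne

lemma SupportedOn.mono (h : SupportedOn r V n c) (hVW : V ⊆ W) : SupportedOn r W n c :=
  fun s hs => ⟨(h s hs).1.trans hVW, (h s hs).2⟩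

lemma SupportedOn.avoid (h : SupportedOn r V n c) : SupportedOn r (V.erase v) n (avoid v c) := by
  intro s hs
  by_cases hv : v ∈ s
  · simp [IndepComplex.avoid, hv] at hs
  · simp only [IndepComplex.avoid, hv, if_false] at hs
    obtain ⟨h1, h2⟩ := h s hs
    exact ⟨subset_erase.2 ⟨h1, hv⟩, h2⟩

lemma SupportedOn.cone (hr : ∀ u v, r u v → r v u) (hv : v ∈ V)
    (hW : ∀ u ∈ W, u ∈ V ∧ u ≠ v ∧ ¬ r u v) (h : SupportedOn r W n c) :
    SupportedOn r V (n + 1) (cone v c) := by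
  intro s hs
  by_cases hvs : v ∈ s
  · simp only [IndepComplex.cone, hvs, if_true] at hs
    obtain ⟨h1, h2, h3⟩ := h _ hs
    refine ⟨?_, ?_, ?_⟩
    · intro u hu
      by_cases huv : u = v
      · exact huv ▸ hv
      · exact (hW u (h1 (mem_erase.2 ⟨huv, hu⟩))).1
    · rw [← h2, card_erase_add_one hvs]
    · intro u hu w hw huw
      by_cases huv : u = v
      · subst huv
        exact fun hh => (hW w (h1 (mem_erase.2 ⟨huw.symm, hw⟩))).2.2 (hr _ _ hh)
      · by_cases hwv : w = v
        · subst hwv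
          exact (hW u (h1 (mem_erase.2 ⟨huw, hu⟩))).2.2
        · exact h3 u (mem_erase.2 ⟨huv, hu⟩) w (mem_erase.2 ⟨hwv, hw⟩) huw
  · simp [IndepComplex.cone, hvs] at hs

lemma SupportedOn.link [DecidableRel r] (h : SupportedOn r V (n + 1) c) :
    SupportedOn r (V.filter fun u => u ≠ v ∧ ¬ r u v) n (link v c) := by
  intro s hs
  by_cases hv : v ∈ s
  · simp [IndepComplex.link, hv] at hs
  · simp only [IndepComplex.link, hv, if_false] at hs
    obtain ⟨h1, h2, h3⟩ := h _ hs
    refine ⟨?_, ?_, ?_⟩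
    · intro u hu
      have huv : u ≠ v := by rintro rfl; exact hv hu
      exact mem_filter.2 ⟨h1 (mem_insert_of_mem hu), huv,
        h3 u (mem_insert_of_mem hu) v (mem_insert_self _ _) huv⟩
    · rw [card_insert_of_notMem hv] at h2
      omega
    · exact fun u hu w hw => h3 u (mem_insert_of_mem hu) w (mem_insert_of_mem hw)

lemma acyclic_of_isolated (hr : ∀ u v, r u v → r v u) (hv : v ∈ V)
    (h : ∀ u ∈ V, u ≠ v → ¬ r u v) : Acyclic r V q := by
  intro n _ z hz hz0
  refine ⟨cone v (avoid v z), hz.avoid.cone hr hv fun u hu => ?_, ?_⟩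
  · rw [mem_erase] at hu
    exact ⟨hu.2, hu.1, h u hu.2 hu.1⟩
  · have hl : boundary (link v z) = 0 := by
      rw [boundary_link, hz0]
      funext s
      simp [link]
    have hb : boundary (avoid v z) = link v z := by
      have h1 := congrArg boundary (avoid_add_cone_link v z)
      rw [hz0, boundary_add, boundary_cone v _ (fun s hs => by simp [link, hs]), hl] at h1
      have h2 : cone v (0 : Finset τ → ZMod 2) = 0 := by funext s; simp [cone]
      rw [h2, add_zero] at h1
      have h3 := congrArg (· + link v z) h1
      simpa [add_assoc, chain_add_self] using h3.symm
    rw [boundary_cone v _ (fun s hs => by simp [avoid, hs]), hb]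
    exact (avoid_add_cone_link v z).symm

lemma acyclic_of_erase [DecidableRel r] (hr : ∀ u v, r u v → r v u)
    (h1 : Acyclic r (V.erase v) (q + 1))
    (h2 : Acyclic r (V.filter fun u => u ≠ v ∧ ¬ r u v) q) : Acyclic r V (q + 1) := by
  by_cases hv : v ∈ V
  swap
  · rwa [erase_eq_of_notMem hv] at h1
  intro n hn z hz hz0
  have hsub : (V.filter fun u => u ≠ v ∧ ¬ r u v) ⊆ V.erase v := by
    intro u hu
    simp only [mem_filter] at hu
    exact mem_erase.2 ⟨hu.2.1, hu.1⟩
  obtain ⟨b, hb, hbz⟩ : ∃ b, SupportedOn r (V.filter fun u => u ≠ v ∧ ¬ r u v) n b ∧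
      boundary b = link v z := by
    cases n with
    | zero =>
      refine ⟨0, fun s hs => absurd rfl hs, ?_⟩
      funext s
      by_contra hne
      have hne' : link v z s ≠ 0 := fun h => hne (by rw [h]; simp [boundary])
      by_cases hvs : v ∈ s
      · simp [link, hvs] at hne'
      · simp only [link, hvs, if_false] at hne'
        have := (hz _ hne').2.1
        simp at this
    | succ m =>
      refine h2 m (by omega) _ hz.link ?_
      rw [boundary_link, hz0]
      funext s
      simp [link]
  have hbv : ∀ s, v ∈ s → b s = 0 := by
    intro s hs
    by_contra hne
    simpa using hsub ((hb s hne).1 hs)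
  have hz' : avoid v z + b = z + boundary (cone v b) := by
    conv_rhs => rw [avoid_add_cone_link v z]
    rw [boundary_cone v b hbv, hbz, add_assoc, add_comm (cone v (link v z)), add_assoc,
      chain_add_self, add_zero]
  obtain ⟨c, hc, hcz⟩ := h1 n hn (avoid v z + b) (hz.avoid.add (hb.mono hsub)) (by
    rw [hz', boundary_add, hz0, boundary_boundary, add_zero])
  refine ⟨c + cone v b, (hc.mono (erase_subset _ _)).add (hb.cone hr hv fun u hu => ?_), ?_⟩
  · simpa using hu
  · rw [boundary_add, hcz, hz', add_assoc, chain_add_self, add_zero]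

lemma acyclic_of_sdiff [DecidableRel r] (hr : ∀ u v, r u v → r v u) (D : Finset τ)
    (h1 : Acyclic r (V \ D) (q + 1))
    (h2 : ∀ v ∈ D, ∀ D' ⊆ D, Acyclic r ((V \ D').filter fun u => u ≠ v ∧ ¬ r u v) q) :
    Acyclic r V (q + 1) := by
  induction D using Finset.induction_on with
  | empty => simpa using h1
  | insert v D _ ih =>
    refine ih (acyclic_of_erase (v := v) hr ?_ ?_) ?_
    · rwa [← sdiff_insert]
    · exact h2 v (mem_insert_self _ _) D (subset_insert _ _)
    · exact fun w hw D' hD' => h2 w (mem_insert_of_mem hw) D' (hD'.trans (subset_insert _ _))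

section Transversal

variable {ξ : Type*} [DecidableEq ξ] (π : τ → ξ)

lemma sum_mul_boundary (g c : Finset τ → ZMod 2) :
    ∑ t, g t * boundary c t = ∑ s, (∑ u ∈ s, g (s.erase u)) * c s := by
  simp only [boundary, mul_sum, sum_mul]
  rw [sum_sigma', sum_sigma']
  refine sum_bij' (fun p _ => ⟨insert p.2 p.1, p.2⟩) (fun p _ => ⟨p.1.erase p.2, p.2⟩)
    ?_ ?_ ?_ ?_ ?_
  · simp
  · simp
  · rintro ⟨t, u⟩ h
    simp at h
    simp [h]
  · rintro ⟨s, u⟩ h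
    simp at h
    simp [h]
  · rintro ⟨t, u⟩ h
    simp at h
    simp [h]

lemma sum_image_erase {K : Finset ξ} {x : ξ} (hx : x ∈ K) {s : Finset τ} (hs : s.card = K.card)
    (hsK : s.image π ⊆ K) :
    (∑ u ∈ s, if (s.erase u).image π = K.erase x then (1 : ZMod 2) else 0) =
      if s.image π = K then 1 else 0 := by
  split_ifs with h
  · have hinj : Set.InjOn π s := card_image_iff.1 (by rw [h, hs])
    obtain ⟨u, hu, hux⟩ : ∃ u ∈ s, π u = x := mem_image.1 (h.symm ▸ hx)
    rw [sum_eq_single u]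
    · rw [if_pos]
      ext y
      have h' : ∀ y, (∃ a ∈ s, π a = y) ↔ y ∈ K := fun y => by rw [← h, mem_image]
      simp only [mem_image, mem_erase]
      constructor
      · rintro ⟨a, ⟨hau, ha⟩, rfl⟩
        exact ⟨fun hh => hau (hinj ha hu (hh.trans hux.symm)), (h' _).1 ⟨a, ha, rfl⟩⟩
      · rintro ⟨hy, hyK⟩
        obtain ⟨a, ha, rfl⟩ := (h' y).2 hyK
        exact ⟨a, ⟨fun hh => hy (hh ▸ hux), ha⟩, rfl⟩
    · intro w hw hwu
      rw [if_neg]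
      intro hh
      have : x ∈ (s.erase w).image π := mem_image.2 ⟨u, mem_erase.2 ⟨hwu.symm, hu⟩, hux⟩
      rw [hh] at this
      simp at this
    · exact fun hh => absurd hu hh
  · by_cases hex : ∃ u ∈ s, (s.erase u).image π = K.erase x
    swap
    · push Not at hex
      exact sum_eq_zero fun u hu => if_neg (hex u hu)
    obtain ⟨u, hu, hue⟩ := hex
    have hinj : Set.InjOn π (s.erase u) := card_image_iff.1 (by
      rw [hue, card_erase_of_mem hx, card_erase_of_mem hu, hs])
    have hux : π u ∈ K.erase x := by
      refine mem_erase.2 ⟨fun hh => h (hsK.antisymm ?_), hsK (mem_image_of_mem _ hu)⟩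
      intro y hy
      by_cases hyx : y = x
      · exact hyx ▸ hh ▸ mem_image_of_mem _ hu
      · have : y ∈ (s.erase u).image π := hue ▸ mem_erase.2 ⟨hyx, hy⟩
        exact image_subset_image (erase_subset _ _) this
    obtain ⟨w, hw, hwu⟩ := mem_image.1 (hue ▸ hux)
    obtain ⟨hne, hws⟩ := mem_erase.1 hw
    have hwe : (s.erase w).image π = K.erase x := by
      rw [← hue]
      ext y
      simp only [mem_image, mem_erase]
      constructor
      · rintro ⟨a, ⟨_, ha⟩, rfl⟩
        by_cases hau : a = u
        · exact ⟨w, ⟨hne, hws⟩, by rw [hwu, hau]⟩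
        · exact ⟨a, ⟨hau, ha⟩, rfl⟩
      · rintro ⟨a, ⟨_, ha⟩, rfl⟩
        by_cases haw : a = w
        · exact ⟨u, ⟨hne.symm, hu⟩, by rw [haw, hwu]⟩
        · exact ⟨a, ⟨haw, ha⟩, rfl⟩
    rw [← sum_subset (s₁ := {u, w})]
    · rw [sum_pair hne.symm, if_pos hue, if_pos hwe]
      exact CharTwo.add_self_eq_zero 1
    · intro a ha
      simp only [mem_insert, mem_singleton] at ha
      rcases ha with rfl | rfl <;> assumption
    · intro a ha hna
      simp only [mem_insert, mem_singleton, not_or] at hna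
      rw [if_neg]
      intro hae
      have hmem : π a ∈ (s.erase a).image π := by
        rw [hae, ← hue]
        exact mem_image_of_mem _ (mem_erase.2 ⟨hna.1, ha⟩)
      obtain ⟨d, hd, hda⟩ := mem_image.1 hmem
      obtain ⟨hdne, hds⟩ := mem_erase.1 hd
      have haw := mem_erase.2 ⟨hna.1, ha⟩
      by_cases hdu : d = u
      · exact hna.2 (hinj haw hw (by rw [← hda, hdu, hwu]))
      · exact hdne (hinj (mem_erase.2 ⟨hdu, hds⟩) haw hda)

lemma exists_transversal_chain (h : ∀ K : Finset ξ, Acyclic r {u | π u ∈ K} K.card) (n : ℕ) :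
    ∃ φ : Finset ξ → Finset τ → ZMod 2, (∀ s, φ ∅ s = if s = ∅ then 1 else 0) ∧
      ∀ K, K.card ≤ n → SupportedOn r {u | π u ∈ K} K.card (φ K) ∧
        (K.Nonempty → boundary (φ K) = ∑ x ∈ K, φ (K.erase x)) := by
  induction n with
  | zero =>
    refine ⟨fun _ s => if s = ∅ then 1 else 0, fun _ => rfl, fun K hK => ?_⟩
    have hK0 : K = ∅ := by simpa using hK
    subst hK0
    refine ⟨fun s hs => ?_, fun hne => absurd hne (by simp)⟩
    have : s = ∅ := by by_contra hne; simp [hne] at hs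
    subst this
    simp
  | succ n ih =>
    obtain ⟨φ, h0, hφ⟩ := ih
    have key : ∀ K : Finset ξ, K.card = n + 1 → ∃ c, SupportedOn r {u | π u ∈ K} (n + 1) c ∧
        boundary c = ∑ x ∈ K, φ (K.erase x) := by
      intro K hK
      refine h K n (by omega) _ (SupportedOn.sum _ _ fun x hx => ?_) ?_
      · have hc : (K.erase x).card = n := by rw [card_erase_of_mem hx]; omega
        have := (hφ (K.erase x) hc.le).1
        rw [hc] at this
        refine this.mono fun u hu => ?_
        simp only [mem_filter, mem_univ, true_and, mem_erase] at hu ⊢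
        exact hu.2
      · rw [boundary_sum]
        rcases n.eq_zero_or_pos with rfl | hn
        · obtain ⟨x, rfl⟩ := card_eq_one.1 hK
          simp only [sum_singleton, erase_singleton]
          funext s
          simp [boundary, h0]
        · have hb : ∀ x ∈ K, boundary (φ (K.erase x)) =
              ∑ y ∈ K.erase x, φ ((K.erase x).erase y) := by
            intro x hx
            have hc : (K.erase x).card = n := by rw [card_erase_of_mem hx]; omega
            exact (hφ _ hc.le).2 (card_pos.1 (by omega))
          rw [sum_congr rfl hb, sum_sigma']
          refine sum_involution (fun p _ => ⟨p.2, p.1⟩) ?_ ?_ ?_ ?_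
          · rintro ⟨x, y⟩ _
            rw [erase_right_comm]
            exact chain_add_self _
          · rintro ⟨x, y⟩ h _ he
            simp at h he
            grind
          · rintro ⟨x, y⟩ h
            simp at h ⊢
            grind
          · rintro ⟨x, y⟩ _
            rfl
    choose! ψ hψ using key
    refine ⟨fun K => if K.card = n + 1 then ψ K else φ K, ?_, fun K hK => ?_⟩
    · simpa using h0
    · have he : ∑ x ∈ K, (if (K.erase x).card = n + 1 then ψ (K.erase x) else φ (K.erase x)) =
          ∑ x ∈ K, φ (K.erase x) := by
        refine sum_congr rfl fun x hx => if_neg ?_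
        rw [card_erase_of_mem hx]
        omega
      rw [he]
      by_cases hc : K.card = n + 1
      · simp only [hc, if_true]
        exact ⟨(hψ K hc).1, fun _ => (hψ K hc).2⟩
      · simp only [hc, if_false]
        exact hφ K (by omega)

/-- The homological Hall theorem: if, for every set `K` of labels, the complex of independent
sets with labels in `K` is acyclic up to `|K|`, there is an independent transversal. -/
theorem exists_independent_transversal [Fintype ξ]
    (h : ∀ K : Finset ξ, Acyclic r {u | π u ∈ K} K.card) :
    ∃ s : Finset τ, (∀ u ∈ s, ∀ v ∈ s, u ≠ v → ¬ r u v) ∧ s.image π = univ ∧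
      s.card = Fintype.card ξ := by
  obtain ⟨φ, h0, hφ⟩ := exists_transversal_chain π h (Fintype.card ξ)
  have key : ∀ K : Finset ξ, ∑ s, (if s.image π = K then 1 else 0) * φ K s = 1 := by
    intro K
    induction K using Finset.strongInduction with
    | H K ih =>
      rcases K.eq_empty_or_nonempty with rfl | hK
      · simp [h0]
      obtain ⟨x, hx⟩ := hK
      obtain ⟨hs, hb⟩ := hφ K (card_le_univ K)
      have h1 := sum_mul_boundary (fun t => if t.image π = K.erase x then 1 else 0) (φ K)
      rw [hb ⟨x, hx⟩] at h1
      have h2 : ∀ s : Finset τ,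
          (∑ u ∈ s, if (s.erase u).image π = K.erase x then (1 : ZMod 2) else 0) * φ K s =
          (if s.image π = K then 1 else 0) * φ K s := by
        intro s
        by_cases h3 : φ K s = 0
        · simp [h3]
        · obtain ⟨h4, h5, _⟩ := hs s h3
          rw [sum_image_erase π hx h5]
          intro y hy
          obtain ⟨u, hu, rfl⟩ := mem_image.1 hy
          simpa using h4 hu
      rw [← sum_congr rfl fun s _ => h2 s, ← h1]
      refine (sum_congr rfl fun t _ => ?_).trans (ih _ (erase_ssubset hx))
      split_ifs with ht
      · simp only [one_mul, Finset.sum_apply]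
        refine sum_eq_single x (fun y hy hyx => ?_) (fun hh => absurd hx hh)
        by_contra hne
        have h6 := ((hφ (K.erase y) (card_le_univ _)).1 t hne).1
        have h7 : y ∈ t.image π := ht ▸ mem_erase.2 ⟨hyx, hy⟩
        obtain ⟨u, hu, rfl⟩ := mem_image.1 h7
        simpa using h6 hu
      · simp
  have hne : ∑ s : Finset τ, (if s.image π = univ then (1 : ZMod 2) else 0) * φ univ s ≠ 0 := by
    rw [key univ]
    exact one_ne_zero
  obtain ⟨s, _, hs⟩ := exists_ne_zero_of_sum_ne_zero hne
  have hsu : s.image π = univ := by by_contra hne; simp [hne] at hs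
  obtain ⟨_, h2, h3⟩ := (hφ univ le_rfl).1 s (right_ne_zero_of_mul hs)
  exact ⟨s, h3, hsu, h2⟩

end Transversal

lemma acyclic_union_clique [DecidableRel r] (hr : ∀ u v, r u v → r v u) {S : Finset τ}
    (hS : S.Nonempty) (hSS : ∀ u ∈ S, ∀ v ∈ S, r u v) (hVS : ∀ u ∈ V, ∀ v ∈ S, ¬ r u v)
    (h : Acyclic r V q) : Acyclic r (V ∪ S) (q + 1) := by
  obtain ⟨f, hf⟩ := hS
  have hdisj : ∀ u ∈ V, u ∉ S := fun u hu hu' => hVS u hu u hu' (hSS u hu' u hu')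
  refine acyclic_of_sdiff hr (S.erase f) ?_ fun v hv D' hD' => ?_
  · refine acyclic_of_isolated (v := f) hr (by simp [hf]) fun u hu huf => ?_
    simp only [mem_sdiff, mem_union, mem_erase] at hu
    exact hVS u (by tauto) f hf
  · have hvS := mem_of_mem_erase hv
    convert h using 1
    ext u
    simp only [mem_filter, mem_sdiff, mem_union]
    constructor
    · rintro ⟨⟨hu | hu, _⟩, _, h2⟩
      · exact hu
      · exact absurd (hSS u hu v hvS) h2
    · intro hu
      exact ⟨⟨Or.inl hu, fun hu' => hdisj u hu (mem_of_mem_erase (hD' hu'))⟩,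
        fun huv => hdisj u hu (huv ▸ hvS), hVS u hu v hvS⟩

section Bipartite

variable {ι η : Type*} [DecidableEq ι] [DecidableEq η]

/-- The elements `u` and `v`, seen as edges joining `col` to `yy`, share an endpoint. -/
def Clash (col : τ → ι) (yy : τ → η) (u v : τ) : Prop := col u = col v ∨ yy u = yy v

instance (col : τ → ι) (yy : τ → η) : DecidableRel (Clash col yy) :=
  fun u v => inferInstanceAs (Decidable (col u = col v ∨ yy u = yy v))

lemma Clash.symm (col : τ → ι) (yy : τ → η) (u v : τ) (h : Clash col yy u v) :
    Clash col yy v u := h.imp Eq.symm Eq.symm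

/-- The matching complex of a simple bipartite graph is acyclic up to `q` if, for each `p` in
`[1, q]`, at least `2 * q - p` vertices of one side have degree at least `p`. -/
theorem acyclic_of_degrees [Fintype ι] (col : τ → ι) (yy : τ → η) (q : ℕ) (V : Finset τ)
    (hinj : ∀ u ∈ V, ∀ v ∈ V, col u = col v → yy u = yy v → u = v)
    (hdeg : ∀ p, 1 ≤ p → p ≤ q → 2 * q ≤ #{c | p ≤ #{u ∈ V | col u = c}} + p) :
    Acyclic (Clash col yy) V q := by
  induction q generalizing V with
  | zero => exact acyclic_zero
  | succ q ih =>
    have h1 := hdeg 1 le_rfl (by omega)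
    obtain ⟨c, hc, hmin⟩ := exists_min_image ({c | 1 ≤ #{u ∈ V | col u = c}} : Finset ι)
      (fun c => #{u ∈ V | col u = c}) (card_pos.1 (by omega))
    obtain ⟨f, hf⟩ := card_pos.1 (mem_filter.1 hc).2
    obtain ⟨hfV, rfl⟩ := mem_filter.1 hf
    have step : ∀ W ⊆ V, ∀ j y, (∀ u ∈ V, col u ≠ col f → col u ≠ j → yy u ≠ y → u ∈ W) →
        Acyclic (Clash col yy) W q := by
      intro W hWV j y hW
      refine ih W (fun u hu v hv => hinj u (hWV hu) v (hWV hv)) fun p hp hpq => ?_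
      have hsub : (({a | p + 1 ≤ #{u ∈ V | col u = a}} : Finset ι).erase (col f)).erase j ⊆
          ({a | p ≤ #{u ∈ W | col u = a}} : Finset ι) := by
        intro a ha
        simp only [mem_erase, mem_filter, mem_univ, true_and] at ha ⊢
        obtain ⟨haj, haf, hap⟩ := ha
        have hone : #{u ∈ V | col u = a ∧ yy u = y} ≤ 1 := by
          refine card_le_one.2 fun u hu v hv => ?_
          simp only [mem_filter] at hu hv
          exact hinj u hu.1 v hv.1 (hu.2.1.trans hv.2.1.symm) (hu.2.2.trans hv.2.2.symm)
        have hle : #{u ∈ V | col u = a} ≤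
            #(({u ∈ W | col u = a} : Finset τ) ∪ {u ∈ V | col u = a ∧ yy u = y}) := by
          refine card_le_card fun u hu => ?_
          simp only [mem_filter, mem_union] at hu ⊢
          obtain ⟨hu, rfl⟩ := hu
          by_cases hy : yy u = y
          · exact Or.inr ⟨hu, rfl, hy⟩
          · exact Or.inl ⟨hW u hu haf haj hy, rfl⟩
        have := card_union_le ({u ∈ W | col u = a} : Finset τ) {u ∈ V | col u = a ∧ yy u = y}
        omega
      have hle := card_le_card hsub
      have he1 := pred_card_le_card_erase (s := ({a | p + 1 ≤ #{u ∈ V | col u = a}} :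
        Finset ι).erase (col f)) (a := j)
      by_cases hfp : p + 1 ≤ #{u ∈ V | col u = col f}
      · have he2 := pred_card_le_card_erase (s := ({a | p + 1 ≤ #{u ∈ V | col u = a}} :
          Finset ι)) (a := col f)
        have h3 : #{a | 1 ≤ #{u ∈ V | col u = a}} ≤ #{a | p + 1 ≤ #{u ∈ V | col u = a}} := by
          refine card_le_card fun a ha => ?_
          have := hmin a ha
          simp only [mem_filter, mem_univ, true_and]
          omega
        omega
      · rw [erase_eq_of_notMem (a := col f) (by simpa using hfp)] at he1 hle
        have := hdeg (p + 1) (by omega) (by omega)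
        omega
    refine acyclic_of_sdiff (Clash.symm col yy) {u ∈ V | col u = col f ∧ u ≠ f} ?_ ?_
    · refine acyclic_of_sdiff (Clash.symm col yy) {u ∈ V | yy u = yy f ∧ u ≠ f} ?_ ?_
      · refine acyclic_of_isolated (v := f) (Clash.symm col yy) (by simp [hfV]) ?_
        intro u hu huf h
        simp only [mem_sdiff, mem_filter] at hu
        rcases h with h | h <;> tauto
      · intro v hv D' hD'
        simp only [mem_filter] at hv
        refine step _ ?_ (col v) (yy v) fun u hu hu1 hu2 hu3 => ?_
        · exact (filter_subset _ _).trans (sdiff_subset.trans sdiff_subset)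
        · refine mem_filter.2 ?_
          simp only [mem_filter, mem_sdiff, Clash]
          refine ⟨⟨⟨hu, by tauto⟩, fun huD => ?_⟩, ?_, by tauto⟩
          · have := (mem_filter.1 (hD' huD)).2.1
            exact hu3 (this.trans hv.2.1.symm)
          · rintro rfl
            exact hu2 rfl
    · intro v hv D' hD'
      simp only [mem_filter] at hv
      refine step _ ?_ (col f) (yy v) fun u hu hu1 hu2 hu3 => ?_
      · exact (filter_subset _ _).trans sdiff_subset
      · refine mem_filter.2 ?_
        simp only [mem_sdiff, Clash, hv.2.1]
        refine ⟨⟨hu, fun huD => ?_⟩, ?_, by tauto⟩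
        · exact hu1 (mem_filter.1 (hD' huD)).2.1
        · rintro rfl
          exact hu3 rfl

/-- A rainbow matching theorem: edges `u` have a colour `col u` and endpoints `xx u`, `yy u`, and
the colour classes are matchings, whose sizes are large enough. -/
theorem exists_rainbow {ξ : Type*} [Fintype ι] [Fintype ξ] [DecidableEq ξ] (k : ℕ)
    (col : τ → ι) (xx : τ → ξ) (yy : τ → η)
    (hx : ∀ u v, col u = col v → xx u = xx v → u = v)
    (hy : ∀ u v, col u = col v → yy u = yy v → u = v)
    (hdeg : ∀ p, 1 ≤ p → p ≤ k → 2 * k ≤ #{c | p ≤ #{u | col u = c}} + p) :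
    ∃ E : Finset τ, #E = k ∧ Set.InjOn col E ∧ Set.InjOn xx E ∧ Set.InjOn yy E := by
  rcases k.eq_zero_or_pos with rfl | hk
  · exact ⟨∅, by simp⟩
  have hkξ : k ≤ Fintype.card ξ := by
    obtain ⟨c, hc⟩ := card_pos.1 (show 0 < #{c | k ≤ #{u | col u = c}} by
      have := hdeg k hk le_rfl
      omega)
    refine (mem_filter.1 hc).2.trans (card_le_card_of_injOn xx (fun _ _ => mem_univ _) ?_)
    intro u hu v hv huv
    simp only [coe_filter, mem_univ, true_and, Set.mem_ofPred_eq] at hu hv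
    exact hx u v (hu.trans hv.symm) huv
  obtain ⟨d, hd⟩ := Nat.exists_eq_add_of_le hkξ
  let col' : τ ⊕ ξ × Fin d → ι ⊕ Fin d := Sum.map col Prod.snd
  let yy' : τ ⊕ ξ × Fin d → η ⊕ Fin d := Sum.map yy Prod.snd
  let π : τ ⊕ ξ × Fin d → ξ := Sum.elim xx Prod.fst
  have hac : ∀ K : Finset ξ, Acyclic (Clash col' yy') {u | π u ∈ K} #K := by
    intro K
    rcases K.eq_empty_or_nonempty with rfl | ⟨x, hxK⟩
    · exact acyclic_zero
    have hbase : Acyclic (Clash col' yy')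
        (({u | xx u ∈ K} : Finset τ).map Function.Embedding.inl) (#K - d) := by
      refine acyclic_of_degrees col' yy' _ _ ?_ fun p hp hpq => ?_
      · intro u hu v hv h1 h2
        obtain ⟨u, _, rfl⟩ := mem_map.1 hu
        obtain ⟨v, _, rfl⟩ := mem_map.1 hv
        exact congrArg _ (hy u v (Sum.inl_injective h1) (Sum.inl_injective h2))
      · have hK : #Kᶜ = Fintype.card ξ - #K := card_compl K
        have hK' : #K ≤ Fintype.card ξ := card_le_univ K
        have h1 := hdeg (p + #Kᶜ) (by omega) (by omega)
        have h2 : #{c | p + #Kᶜ ≤ #{u | col u = c}} ≤ #{c | p ≤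
            #{u ∈ ({u | xx u ∈ K} : Finset τ).map Function.Embedding.inl | col' u = c}} := by
          refine card_le_card_of_injOn Sum.inl ?_ Sum.inl_injective.injOn
          intro c hc
          simp only [coe_filter, mem_univ, true_and, Set.mem_ofPred_eq] at hc ⊢
          have h3 : #{u | col u = c} ≤ #{u | xx u ∈ K ∧ col u = c} +
              #{u | xx u ∉ K ∧ col u = c} := by
            refine le_trans (card_le_card fun u hu => ?_) (card_union_le _ _)
            simp only [mem_filter, mem_univ, true_and, mem_union] at hu ⊢
            tauto
          have h4 : #{u | xx u ∉ K ∧ col u = c} ≤ #Kᶜ := by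
            refine card_le_card_of_injOn xx (fun u hu => ?_) fun u hu v hv huv => ?_
            · simp at hu ⊢
              exact hu.1
            · simp only [coe_filter, mem_univ, true_and, Set.mem_ofPred_eq] at hu hv
              exact hx u v (hu.2.trans hv.2.symm) huv
          have h5 : #{u | xx u ∈ K ∧ col u = c} ≤
              #{u ∈ ({u | xx u ∈ K} : Finset τ).map Function.Embedding.inl |
                col' u = Sum.inl c} := by
            refine card_le_card_of_injOn Sum.inl (fun u hu => ?_) Sum.inl_injective.injOn
            simpa [col'] using hu
          omega
        omega
    have hdummy : ∀ D : Finset (Fin d), Acyclic (Clash col' yy')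
        (({u | xx u ∈ K} : Finset τ).map Function.Embedding.inl ∪
          (K ×ˢ D).map Function.Embedding.inr) (#K - d + #D) := by
      intro D
      induction D using Finset.induction_on with
      | empty => simpa using hbase
      | insert a D ha ih =>
        rw [card_insert_of_notMem ha, ← add_assoc]
        have := acyclic_union_clique (S := (K ×ˢ {a}).map Function.Embedding.inr)
          (Clash.symm col' yy') ⟨Sum.inr (x, a), by simp [hxK]⟩ ?_ ?_ ih
        · convert this using 1
          ext u
          rcases u with u | ⟨y, b⟩ <;> simp
          tauto
        · rintro (u | ⟨y, b⟩) hu (v | ⟨z, e⟩) hv <;> simp at hu hv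
          exact Or.inl (congrArg Sum.inr (hu.2.symm.trans hv.2))
        · rintro (u | ⟨y, b⟩) hu (v | ⟨z, e⟩) hv <;> simp at hu hv
          · simp [Clash, col', yy']
          · simp only [Clash, col', yy', Sum.map_inr, Sum.inr.injEq, or_self]
            rintro rfl
            exact ha (hv.2 ▸ hu.2)
    have hall := hdummy univ
    rw [card_univ, Fintype.card_fin] at hall
    refine ?_
    convert hall.mono (q' := #K) (by omega) using 1
    ext u
    rcases u with u | ⟨y, b⟩ <;> simp [π]
  obtain ⟨s, hind, himg, hcard⟩ := exists_independent_transversal π hac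
  have hπ : Set.InjOn π s := card_image_iff.1 (by rw [himg, hcard, card_univ])
  have hright : #s.toRight ≤ d := by
    refine le_trans (card_le_card_of_injOn Prod.snd (fun _ _ => mem_univ _) ?_)
      (by simp : #(univ : Finset (Fin d)) ≤ d)
    intro u hu v hv huv
    by_contra hne
    refine hind (Sum.inr u) (by simpa using hu) (Sum.inr v) (by simpa using hv) (by simpa) ?_
    exact Or.inl (congrArg Sum.inr huv)
  have hsum := card_toLeft_add_card_toRight (u := s)
  obtain ⟨E, hE, hEk⟩ := exists_subset_card_eq (s := s.toLeft) (n := k) (by omega)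
  have hEs : ∀ u ∈ E, Sum.inl u ∈ s := fun u hu => by simpa using hE hu
  refine ⟨E, hEk, fun u hu v hv huv => ?_, fun u hu v hv huv => ?_, fun u hu v hv huv => ?_⟩
  · by_contra hne
    exact hind _ (hEs u hu) _ (hEs v hv) (by simpa) (Or.inl (congrArg Sum.inl huv))
  · exact Sum.inl_injective (hπ (hEs u hu) (hEs v hv) huv)
  · by_contra hne
    exact hind _ (hEs u hu) _ (hEs v hv) (by simpa) (Or.inr (congrArg Sum.inl huv))

end Bipartite

end IndepComplex

open Finset in
/-- Aharoni–Berger–Kotlar–Ziv: matchings `F_1, …, F_{2k-1}` in a bipartite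
graph with `|F_i| = min(i, k)` have a rainbow matching of size `k`. -/
theorem stmt_17 {α β : Type*} (k : ℕ) (F : Fin (2 * k - 1) → Finset (α × β))
    (hmatch : ∀ i, IsMatching (↑(F i) : Set (α × β)))
    (hcard : ∀ i : Fin (2 * k - 1), (F i).card = min ((i : ℕ) + 1) k) :
    HasRainbowMatchingOfSize k (fun i => (↑(F i) : Set (α × β))) := by
  classical
  let col : (Σ i, {e // e ∈ F i}) → Fin (2 * k - 1) := Sigma.fst
  let X : Finset α := univ.biUnion fun i => (F i).image Prod.fst
  let xx : (Σ i, {e // e ∈ F i}) → {x // x ∈ X} := fun u =>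
    ⟨u.2.1.1, mem_biUnion.2 ⟨u.1, mem_univ _, mem_image_of_mem _ u.2.2⟩⟩
  let yy : (Σ i, {e // e ∈ F i}) → β := fun u => u.2.1.2
  have hX : ∀ u v, col u = col v → xx u = xx v → u = v := by
    rintro ⟨i, e, he⟩ ⟨j, f, hf⟩ (rfl : i = j) h
    by_contra hne
    refine (hmatch i e he f hf ?_).1 (congrArg Subtype.val h)
    rintro rfl
    exact hne rfl
  have hY : ∀ u v, col u = col v → yy u = yy v → u = v := by
    rintro ⟨i, e, he⟩ ⟨j, f, hf⟩ (rfl : i = j) h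
    by_contra hne
    refine (hmatch i e he f hf ?_).2 h
    rintro rfl
    exact hne rfl
  have hdeg : ∀ p, 1 ≤ p → p ≤ k → 2 * k ≤ #{c | p ≤ #{u | col u = c}} + p := by
    intro p hp hpk
    have hcardcol : ∀ i, #{u | col u = i} = min ((i : ℕ) + 1) k := by
      intro i
      rw [← hcard i, ← card_attach (s := F i)]
      symm
      refine card_bij (fun e _ => ⟨i, e⟩) (by simp [col]) (by simp) ?_
      rintro ⟨j, e⟩ h
      obtain rfl : j = i := by simpa [col] using h
      exact ⟨e, by simp, rfl⟩
    have hsub : (univ : Finset (Fin (2 * k - p))).card ≤ #{c | p ≤ #{u | col u = c}} := by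
      refine card_le_card_of_injOn
        (fun i => ⟨i.1 + (p - 1), by have := i.2; omega⟩) (fun i _ => ?_) ?_
      · simp only [hcardcol, coe_filter, mem_univ, true_and, Set.mem_ofPred_eq]
        omega
      · intro i _ j _ h
        simp only [Fin.mk.injEq] at h
        omega
    rw [card_univ, Fintype.card_fin] at hsub
    omega
  obtain ⟨E, hE, hcol, hxx, hyy⟩ := IndepComplex.exists_rainbow k col xx yy hX hY hdeg
  let φ := (E.equivFinOfCardEq hE).symm
  have hφ : ∀ a b, (φ a : Σ i, {e // e ∈ F i}) = φ b → a = b :=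
    fun a b h => φ.injective (Subtype.ext h)
  have hx : ∀ a b, (φ a).1.2.1.1 = (φ b).1.2.1.1 → a = b := fun a b h =>
    hφ a b (hxx (φ a).2 (φ b).2 (Subtype.ext h))
  have hy : ∀ a b, (φ a).1.2.1.2 = (φ b).1.2.1.2 → a = b := fun a b h =>
    hφ a b (hyy (φ a).2 (φ b).2 h)
  refine ⟨⟨fun a => (φ a).1.1, fun a b h => hφ a b (hcol (φ a).2 (φ b).2 h)⟩,
    fun a => (φ a).1.2.1, fun a b h => hx a b (congrArg Prod.fst h),
    fun a => (φ a).1.2.2, ?_⟩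
  rintro _ ⟨a, rfl⟩ _ ⟨b, rfl⟩ hne
  exact ⟨fun h => hne (by rw [hx a b h]), fun h => hne (by rw [hy a b h])⟩
end
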